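/- Fix a real number c > 0 and for each n set t_n = ⌊cn⌋. Then liminf_{n→∞} ‖μ_{t_n+1} − U_{t_n+1}‖_TV ≥ (1 − e^{e^{−2c}} + e^{e^{−2c}−2c})/e and limsup_{n→∞} ‖μ_{t_n+1} − U_{t_n+1}‖_TV ≤ e^{−4c}/(2·√(1−e^{−4c})). -/

import Mathlib

-- Common setup for the random (n-k)-cycle to transpositions walk on the symmetric group.
open Finset Filter Real

noncomputable section

/-- Convolution of two (probability) distributions on `S_n`. -/
def conv {n : ℕ} (μ ν : Equiv.Perm (Fin n) → ℝ) : Equiv.Perm (Fin n) → ℝ :=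
  fun g => ∑ h : Equiv.Perm (Fin n), μ (g * h⁻¹) * ν h

/-- `t`-fold convolution power (with `μ^{*0}` the point mass at the identity). -/
def convPow {n : ℕ} (μ : Equiv.Perm (Fin n) → ℝ) : ℕ → (Equiv.Perm (Fin n) → ℝ)
  | 0 => fun g => if g = 1 then 1 else 0
  | t + 1 => conv (convPow μ t) μ

/-- Uniform probability distribution on a finite set of permutations. -/
def unifOn {n : ℕ} (S : Finset (Equiv.Perm (Fin n))) : Equiv.Perm (Fin n) → ℝ :=
  fun g => if g ∈ S then (1 : ℝ) / S.card else 0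

/-- The set of `(n-k)`-cycles of `S_n`: one cycle of length `n - k` and `k` fixed points. -/
def cycles (n k : ℕ) : Finset (Equiv.Perm (Fin n)) :=
  letI := Classical.decPred fun σ : Equiv.Perm (Fin n) => σ.IsCycle ∧ σ.support.card = n - k
  Finset.univ.filter fun σ : Equiv.Perm (Fin n) => σ.IsCycle ∧ σ.support.card = n - k

/-- The set of transpositions of `S_n`. -/
def transpositions (n : ℕ) : Finset (Equiv.Perm (Fin n)) :=
  letI := Classical.decPred fun σ : Equiv.Perm (Fin n) => σ.IsSwap
  Finset.univ.filter fun σ : Equiv.Perm (Fin n) => σ.IsSwap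

/-- The law `μ_{t+1} = ν_n * τ_n^{*t}` of the walk after the initial random `(n-k)`-cycle
and `t` random transpositions. -/
def walk (n k t : ℕ) : Equiv.Perm (Fin n) → ℝ :=
  conv (unifOn (cycles n k)) (convPow (unifOn (transpositions n)) t)

/-- The alternating group `A_n` as a finset. -/
def evenPerms (n : ℕ) : Finset (Equiv.Perm (Fin n)) :=
  Finset.univ.filter fun σ => Equiv.Perm.sign σ = 1

/-- `S_n \ A_n` as a finset. -/
def oddPerms (n : ℕ) : Finset (Equiv.Perm (Fin n)) :=
  Finset.univ.filter fun σ => ¬ (Equiv.Perm.sign σ = 1)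

/-- The stationary distribution `U_s` at step `s`: uniform on `A_n` if `s` and `n - k`
have the same parity, uniform on `S_n \ A_n` otherwise. -/
def stationary (n k s : ℕ) : Equiv.Perm (Fin n) → ℝ :=
  if s % 2 = (n - k) % 2 then unifOn (evenPerms n) else unifOn (oddPerms n)

/-- Total variation distance between two distributions on `S_n`. -/
def tvDist {n : ℕ} (μ ν : Equiv.Perm (Fin n) → ℝ) : ℝ :=
  (1 / 2) * ∑ σ : Equiv.Perm (Fin n), |μ σ - ν σ|

/-- The number of fixed points of a permutation. -/
def fixCount {n : ℕ} (σ : Equiv.Perm (Fin n)) : ℕ :=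
  (Finset.univ.filter fun i => σ i = i).card

end

namespace CW
set_option linter.unusedSectionVars false

section mat
variable {α : Type*} [Fintype α] [DecidableEq α]

/-- permutation matrix -/
noncomputable def Z (σ : Equiv.Perm α) : Matrix α α ℝ :=
  Matrix.of fun i j => if i = σ j then 1 else 0

lemma Z_apply (σ : Equiv.Perm α) (i j : α) : Z σ i j = if i = σ j then 1 else 0 := rfl

lemma Z_mul_apply (σ : Equiv.Perm α) (A : Matrix α α ℝ) (k i : α) :
    (Z σ * A) k i = A (σ⁻¹ k) i := by
  simp only [Matrix.mul_apply, Z_apply, ite_mul, one_mul, zero_mul]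
  rw [Finset.sum_eq_single (σ⁻¹ k)]
  · simp
  · intro b _ hb
    rw [if_neg]
    rintro rfl
    simp at hb
  · simp

lemma Z_mul (σ τ : Equiv.Perm α) : Z (σ * τ) = Z σ * Z τ := by
  ext k i
  rw [Z_mul_apply, Z_apply, Z_apply]
  simp only [Equiv.Perm.inv_eq_iff_eq, Equiv.Perm.mul_apply]
  congr

lemma Z_one : Z (1 : Equiv.Perm α) = 1 := by
  ext k i
  rw [Z_apply, Matrix.one_apply, Equiv.Perm.one_apply]

/-- the matrix `1 - xσ` -/
noncomputable def B (σ : Equiv.Perm α) (x : ℝ) : Matrix α α ℝ := 1 - x • Z σ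

/-- the polynomial `det(1 - xσ)` -/
noncomputable def pd (σ : Equiv.Perm α) (x : ℝ) : ℝ := (B σ x).det

/-- the period of `i` -/
noncomputable def per (σ : Equiv.Perm α) (i : α) : ℕ := Function.minimalPeriod σ i

lemma per_pos (σ : Equiv.Perm α) (i : α) : 0 < per σ i := by
  apply Function.minimalPeriod_pos_of_mem_periodicPts
  exact Function.Injective.mem_periodicPts σ.injective i

lemma pow_per (σ : Equiv.Perm α) (i : α) : (σ ^ per σ i) i = i := by
  have := Function.iterate_minimalPeriod (f := σ) (x := i)
  rwa [← Equiv.Perm.coe_pow] at this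

lemma per_dvd (σ : Equiv.Perm α) (i : α) (m : ℕ) : (σ ^ m) i = i ↔ per σ i ∣ m := by
  unfold per
  rw [← Function.isPeriodicPt_iff_minimalPeriod_dvd, Equiv.Perm.coe_pow]
  rfl

/-- explicit inverse of `1 - xσ` -/
noncomputable def Rm (σ : Equiv.Perm α) (x : ℝ) : Matrix α α ℝ :=
  Matrix.of fun k i => (1 - x ^ per σ i)⁻¹ *
    ∑ m ∈ range (per σ i), x ^ m * (if k = (σ ^ m) i then 1 else 0)

lemma one_sub_pow_pos {x : ℝ} (hx : |x| < 1) {m : ℕ} (hm : 0 < m) : 0 < 1 - x ^ m := by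
  have : |x ^ m| < 1 := by
    rw [abs_pow]; exact pow_lt_one₀ (abs_nonneg _) hx hm.ne'
  have := (abs_lt.1 this).2
  linarith

lemma B_mul_Rm (σ : Equiv.Perm α) {x : ℝ} (hx : |x| < 1) : B σ x * Rm σ x = 1 := by
  ext k i
  have h1 := (one_sub_pow_pos hx (per_pos σ i)).ne'
  rw [B, Matrix.sub_mul, Matrix.one_mul, Matrix.smul_mul, Matrix.sub_apply, Matrix.smul_apply,
    Z_mul_apply, Matrix.one_apply]
  simp only [Rm, Matrix.of_apply, smul_eq_mul]
  have h2 : ∀ m : ℕ, (σ⁻¹ k = (σ ^ m) i) = (k = (σ ^ (m+1)) i) := by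
    intro m
    rw [Equiv.Perm.inv_eq_iff_eq, pow_succ', Equiv.Perm.mul_apply]
  simp only [h2]
  have h3 := Finset.sum_range_sub' (fun m => x ^ m * (if k = (σ ^ m) i then (1:ℝ) else 0)) (per σ i)
  have h4 : ∑ m ∈ range (per σ i), x ^ m * (if k = (σ ^ m) i then (1:ℝ) else 0)
      - x * ∑ m ∈ range (per σ i), x ^ m * (if k = (σ ^ (m+1)) i then (1:ℝ) else 0)
      = (1 - x ^ per σ i) * (if k = i then 1 else 0) := by
    rw [Finset.mul_sum, ← Finset.sum_sub_distrib]
    rw [pow_per] at h3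
    simp only [pow_zero, Equiv.Perm.one_apply] at h3
    rw [sub_mul, one_mul, ← one_mul (if k = i then (1:ℝ) else 0), mul_ite, ← mul_ite]
    simp only [one_mul] at h3 ⊢
    rw [← h3]
    refine Finset.sum_congr rfl fun m _ => ?_
    ring
  calc _ = (1 - x ^ per σ i)⁻¹ * (∑ m ∈ range (per σ i), x ^ m * (if k = (σ ^ m) i then (1:ℝ) else 0)
      - x * ∑ m ∈ range (per σ i), x ^ m * (if k = (σ ^ (m+1)) i then (1:ℝ) else 0)) := by ring
    _ = _ := by rw [h4, inv_mul_cancel_left₀ h1]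

lemma Rm_mul_B (σ : Equiv.Perm α) {x : ℝ} (hx : |x| < 1) : Rm σ x * B σ x = 1 :=
  mul_eq_one_comm.1 (B_mul_Rm σ hx)

lemma isUnit_pd (σ : Equiv.Perm α) {x : ℝ} (hx : |x| < 1) : IsUnit (B σ x).det :=
  (Matrix.isUnit_iff_isUnit_det _).1 (IsUnit.of_mul_eq_one _ (B_mul_Rm σ hx))

lemma pd_ne (σ : Equiv.Perm α) {x : ℝ} (hx : |x| < 1) : pd σ x ≠ 0 := (isUnit_pd σ hx).ne_zero

lemma B_inv (σ : Equiv.Perm α) {x : ℝ} (hx : |x| < 1) : (B σ x)⁻¹ = Rm σ x :=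
  Matrix.inv_eq_right_inv (B_mul_Rm σ hx)

lemma Rm_eq (σ : Equiv.Perm α) {x : ℝ} (hx : |x| < 1) : Rm σ x = 1 + x • (Z σ * Rm σ x) := by
  have h := B_mul_Rm σ hx
  rw [B, Matrix.sub_mul, Matrix.one_mul, Matrix.smul_mul] at h
  rw [← h]; abel_nf

lemma Rm_eq' (σ : Equiv.Perm α) {x : ℝ} (hx : |x| < 1) : Rm σ x = 1 + x • (Rm σ x * Z σ) := by
  have h := Rm_mul_B σ hx
  rw [B, Matrix.mul_sub, Matrix.mul_one, Matrix.mul_smul] at h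
  rw [← h]; abel_nf

/-- `tr (σ (1 - xσ)⁻¹)` -/
noncomputable def trN (σ : Equiv.Perm α) (x : ℝ) : ℝ := (Z σ * Rm σ x).trace

lemma trN_eq (σ : Equiv.Perm α) (x : ℝ) :
    trN σ x = ∑ i, x ^ (per σ i - 1) / (1 - x ^ per σ i) := by
  unfold trN Matrix.trace
  refine Finset.sum_congr rfl fun i _ => ?_
  rw [Matrix.diag_apply, Z_mul_apply]
  simp only [Rm, Matrix.of_apply]
  have h2 : ∀ m : ℕ, (σ⁻¹ i = (σ ^ m) i) = (per σ i ∣ m + 1) := by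
    intro m
    rw [Equiv.Perm.inv_eq_iff_eq, ← Equiv.Perm.mul_apply, ← pow_succ', ← per_dvd]
    exact propext eq_comm
  simp only [h2]
  have hp := per_pos σ i
  rw [Finset.sum_eq_single (per σ i - 1)]
  · rw [Nat.sub_add_cancel hp]; simp; ring
  · intro m hm hne
    rw [if_neg, mul_zero]
    intro hd
    have := Nat.le_of_dvd (by omega) hd
    have := Finset.mem_range.1 hm
    omega
  · intro h; exact absurd (Finset.mem_range.2 (by omega)) h

lemma pd_deriv (σ : Equiv.Perm α) {x : ℝ} (hx : |x| < 1) :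
    HasDerivAt (pd σ) (-(pd σ x * trN σ x)) x := by
  let M : Matrix α α ℝ := -(Z σ * Rm σ x)
  let q : Polynomial ℝ := (1 + (Polynomial.X : Polynomial ℝ) • M.map Polynomial.C).det
  have hq : ∀ h : ℝ, q.eval h = (1 + h • M).det := by
    intro h
    simp only [q]
    rw [← Polynomial.coe_evalRingHom, RingHom.map_det]
    congr 1
    ext i j
    simp [Matrix.one_apply, apply_ite (Polynomial.eval h)]
    exact mul_comm _ _
  have hdet : ∀ y : ℝ, pd σ y = q.eval (y - x) * pd σ x := by
    intro y
    rw [hq, pd, pd, ← Matrix.det_mul]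
    congr 1
    have : Z σ * Rm σ x * B σ x = Z σ := by rw [Matrix.mul_assoc, Rm_mul_B σ hx, Matrix.mul_one]
    simp only [M]
    rw [Matrix.add_mul, Matrix.one_mul, Matrix.smul_mul, Matrix.neg_mul, this]
    simp only [B]
    module
  have hd : HasDerivAt (fun y => q.eval (y - x) * pd σ x) (M.trace * pd σ x) x := by
    have h0 : HasDerivAt (fun y => q.eval y) M.trace (x - x) := by
      have := q.hasDerivAt (x - x)
      rwa [sub_self, Matrix.derivative_det_one_add_X_smul, ← sub_self x] at this
    have h1 := HasDerivAt.comp (h := fun y => y - x) x h0 ((hasDerivAt_id' x).sub_const x)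
    have := h1.mul_const (pd σ x)
    rw [mul_one] at this
    exact this
  have he : pd σ = fun y => q.eval (y - x) * pd σ x := funext hdet
  rw [he]
  refine hd.congr_deriv ?_
  simp only [M, Matrix.trace_neg, trN]
  rw [sub_self, hq]
  simp; ring

lemma pd_zero (σ : Equiv.Perm α) : pd σ 0 = 1 := by simp [pd, B]

/-- `∑ (1/ℓ_i) log (1 - x^ℓ_i)` -/
noncomputable def lp (σ : Equiv.Perm α) (x : ℝ) : ℝ :=
  ∑ i, (1 / (per σ i : ℝ)) * Real.log (1 - x ^ per σ i)

lemma lp_deriv (σ : Equiv.Perm α) {x : ℝ} (hx : |x| < 1) :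
    HasDerivAt (lp σ) (-trN σ x) x := by
  rw [trN_eq, ← Finset.sum_neg_distrib]
  unfold lp
  have : ∀ i ∈ (Finset.univ : Finset α), HasDerivAt
      (fun x : ℝ => (1 / (per σ i : ℝ)) * Real.log (1 - x ^ per σ i))
      (-(x ^ (per σ i - 1) / (1 - x ^ per σ i))) x := by
    intro i _
    have h1 := (one_sub_pow_pos hx (per_pos σ i)).ne'
    have h2 := (((hasDerivAt_pow (per σ i) x).const_sub 1).log h1).const_mul (1 / (per σ i : ℝ))
    refine h2.congr_deriv ?_
    have : (per σ i : ℝ) ≠ 0 := by exact_mod_cast (per_pos σ i).ne'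
    rw [neg_div, mul_neg, ← mul_div_assoc, ← mul_assoc, one_div, inv_mul_cancel₀ this, one_mul]
  exact HasDerivAt.fun_sum this

lemma pd_eq_exp (σ : Equiv.Perm α) {x : ℝ} (hx : 0 ≤ x) (hx1 : x < 1) :
    pd σ x = Real.exp (lp σ x) := by
  have hd : ∀ y ∈ Set.Ioo (-1 : ℝ) 1, HasDerivAt (fun y => pd σ y * Real.exp (- lp σ y)) 0 y := by
    intro y hy
    have hy' : |y| < 1 := abs_lt.2 hy
    have := (pd_deriv σ hy').mul ((lp_deriv σ hy').neg.exp)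
    refine this.congr_deriv ?_
    simp only [Pi.neg_apply]
    ring
  have hc : (fun y => pd σ y * Real.exp (- lp σ y)) x = (fun y => pd σ y * Real.exp (- lp σ y)) 0 := by
    refine IsOpen.is_const_of_deriv_eq_zero (f := fun y => pd σ y * Real.exp (- lp σ y))
      (isOpen_Ioo (a := (-1:ℝ)) (b := 1)) (isPreconnected_Ioo) ?_ ?_ ?_ ?_
    · intro y hy; exact (hd y hy).differentiableAt.differentiableWithinAt
    · intro y hy; exact (hd y hy).deriv
    · constructor <;> linarith
    · constructor <;> norm_num
  have h0 : lp σ 0 = 0 := by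
    unfold lp
    refine Finset.sum_eq_zero fun i _ => ?_
    rw [zero_pow (per_pos σ i).ne']; simp
  simp only [pd_zero, h0, neg_zero, Real.exp_zero, mul_one] at hc
  rw [Real.exp_neg] at hc
  field_simp at hc
  exact hc

end mat
end CW

namespace CW
section mat2
set_option linter.unusedSectionVars false
variable {α : Type*} [Fintype α] [DecidableEq α]

/-- the vector `e_i - e_j` -/
noncomputable def vv (i j : α) : α → ℝ := Pi.single i 1 - Pi.single j 1

/-- the quadratic form of `e_i - e_j` -/
noncomputable def qf (A : Matrix α α ℝ) (i j : α) : ℝ := A i i + A j j - A i j - A j i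

lemma vv_qf (A : Matrix α α ℝ) (i j : α) : vv i j ⬝ᵥ (A.mulVec (vv i j)) = qf A i j := by
  simp only [vv, Matrix.mulVec_sub, sub_dotProduct, dotProduct_sub, Matrix.mulVec_single_one,
    single_one_dotProduct, Matrix.col_apply, qf]
  ring

lemma Z_swap (i j : α) : Z (Equiv.swap i j) = 1 - Matrix.vecMulVec (vv i j) (vv i j) := by
  ext k l
  simp only [Z_apply, Matrix.sub_apply, Matrix.one_apply, Matrix.vecMulVec_apply, vv,
    Pi.sub_apply, Pi.single_apply, Equiv.swap_apply_def]
  by_cases h1 : l = i <;> by_cases h2 : l = j <;> by_cases h3 : k = i <;> by_cases h4 : k = j <;>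
    by_cases h5 : k = l <;> by_cases h6 : i = j <;> simp_all

lemma Z_mul_swap (σ : Equiv.Perm α) (i j : α) :
    Z (σ * Equiv.swap i j) = Z σ - Matrix.vecMulVec ((Z σ).mulVec (vv i j)) (vv i j) := by
  rw [Z_mul, Z_swap, Matrix.mul_sub, Matrix.mul_one, Matrix.mul_vecMulVec]

lemma tr_swap (σ : Equiv.Perm α) (i j : α) :
    (Z (σ * Equiv.swap i j)).trace = (Z σ).trace - qf (Z σ) i j := by
  rw [Z_mul_swap, Matrix.trace_sub, Matrix.trace_vecMulVec, dotProduct_comm, vv_qf]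

lemma pd_swap (σ : Equiv.Perm α) {x : ℝ} (hx : |x| < 1) (i j : α) :
    pd (σ * Equiv.swap i j) x = pd σ x * (1 + qf (Rm σ x - 1) i j) := by
  have h1 : B (σ * Equiv.swap i j) x = B σ x + Matrix.replicateCol Unit (x • (Z σ).mulVec (vv i j)) *
      Matrix.replicateRow Unit (vv i j) := by
    rw [← Matrix.vecMulVec_eq, B, B, Z_mul_swap, Matrix.smul_vecMulVec]
    module
  rw [pd, h1, Matrix.det_add_replicateCol_mul_replicateRow (isUnit_pd σ hx), B_inv σ hx]
  have h2 : Rm σ x - 1 = x • (Rm σ x * Z σ) := by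
    nth_rewrite 1 [Rm_eq' σ hx]; simp
  rw [h2, ← vv_qf, pd]
  congr 1
  rw [Matrix.det_unique, Matrix.add_apply, Matrix.one_apply_eq, Matrix.mul_assoc,
    ← Matrix.replicateCol_mulVec, Matrix.replicateRow_mul_replicateCol_apply, Matrix.mulVec_smul, Matrix.smul_mulVec,
    Matrix.mulVec_mulVec]

lemma sum_qf (A : Matrix α α ℝ) :
    ∑ i, ∑ j, qf A i j = 2 * (Fintype.card α) * A.trace - 2 * ∑ i, ∑ j, A i j := by
  simp only [qf, Finset.sum_sub_distrib, Finset.sum_add_distrib, Finset.sum_const, Finset.card_univ,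
    nsmul_eq_mul, Matrix.trace, Matrix.diag_apply, ← Finset.mul_sum]
  rw [Finset.sum_comm (f := fun i j => A j i)]
  ring

lemma sum_qf_qf (A C : Matrix α α ℝ) (a c : ℝ) (ha : ∀ i, ∑ j, A i j = a) (ha' : ∀ i, ∑ j, A j i = a)
    (hc : ∀ i, ∑ j, C i j = c) (hc' : ∀ i, ∑ j, C j i = c) :
    ∑ i, ∑ j, qf A i j * qf C i j = 2 * Fintype.card α * (∑ i, A i i * C i i)
      + 2 * A.trace * C.trace - 4 * A.trace * c - 4 * C.trace * a
      + 2 * ∑ i, ∑ j, A i j * C i j + 2 * ∑ i, ∑ j, A i j * C j i := by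
  have e : ∀ i j, qf A i j * qf C i j =
      A i i * C i i + A j j * C j j + A i i * C j j + A j j * C i i
      - A i i * C i j - A i i * C j i - A j j * C i j - A j j * C j i
      - A i j * C i i - A j i * C i i - A i j * C j j - A j i * C j j
      + A i j * C i j + A j i * C j i + A i j * C j i + A j i * C i j := by
    intro i j; simp only [qf]; ring
  simp only [e, Finset.sum_sub_distrib, Finset.sum_add_distrib]
  rw [Finset.sum_comm (f := fun i j => A j j * C i j), Finset.sum_comm (f := fun i j => A j j * C j i),
    Finset.sum_comm (f := fun i j => A i j * C j j), Finset.sum_comm (f := fun i j => A j i * C j j),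
    Finset.sum_comm (f := fun i j => A j i * C j i), Finset.sum_comm (f := fun i j => A j i * C i j)]
  simp only [← Finset.mul_sum, ← Finset.sum_mul, ha, ha', hc, hc', Finset.sum_const, Finset.card_univ,
    nsmul_eq_mul, Matrix.trace, Matrix.diag_apply]
  have e2 : ∑ i, (Fintype.card α : ℝ) * (A i i * C i i) = Fintype.card α * ∑ i, A i i * C i i := by
    rw [Finset.mul_sum]
  have e3 : ∑ i, A i i * ((Fintype.card α : ℝ) * C i i) = Fintype.card α * ∑ i, A i i * C i i := by
    rw [Finset.mul_sum]
    exact Finset.sum_congr rfl fun i _ => by ring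
  try rw [e2]
  try rw [e3]
  ring_nf
  try simp only [mul_assoc, mul_left_comm _ (Fintype.card α : ℝ), ← Finset.mul_sum]
  try ring

lemma Z_row (σ : Equiv.Perm α) (i : α) : ∑ j, Z σ i j = 1 := by
  simp only [Z_apply]
  have : ∀ j, (i = σ j) = (σ⁻¹ i = j) := fun j => by rw [Equiv.Perm.inv_eq_iff_eq]
  simp [this]

lemma Z_col (σ : Equiv.Perm α) (i : α) : ∑ j, Z σ j i = 1 := by
  simp [Z_apply]

lemma Rm_row (σ : Equiv.Perm α) {x : ℝ} (hx : |x| < 1) (i : α) :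
    ∑ j, (Rm σ x - 1) i j = x / (1 - x) := by
  have h1 : (1 : ℝ) - x ≠ 0 := by have := (abs_lt.1 hx).2; linarith
  have hB : (B σ x).mulVec 1 = (1 - x) • 1 := by
    ext k
    simp only [B, Matrix.mulVec, dotProduct, Pi.one_apply, mul_one, Matrix.sub_apply,
      Matrix.smul_apply, Finset.sum_sub_distrib, smul_eq_mul, ← Finset.mul_sum, Z_row, Pi.smul_apply]
    simp [Matrix.one_apply]
  have h2 : (Rm σ x).mulVec ((B σ x).mulVec 1) = 1 := by
    rw [Matrix.mulVec_mulVec, Rm_mul_B σ hx, Matrix.one_mulVec]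
  rw [hB, Matrix.mulVec_smul] at h2
  have h3 := congrFun h2 i
  simp only [Pi.smul_apply, Matrix.mulVec, dotProduct, Pi.one_apply, mul_one, smul_eq_mul] at h3
  simp only [Matrix.sub_apply, Finset.sum_sub_distrib]
  have h4 : ∑ j, (1 : Matrix α α ℝ) i j = 1 := by simp [Matrix.one_apply]
  rw [h4]
  field_simp
  linarith

lemma Rm_col (σ : Equiv.Perm α) {x : ℝ} (hx : |x| < 1) (i : α) :
    ∑ j, (Rm σ x - 1) j i = x / (1 - x) := by
  have h1 : (1 : ℝ) - x ≠ 0 := by have := (abs_lt.1 hx).2; linarith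
  have hB : Matrix.vecMul 1 (B σ x) = (1 - x) • 1 := by
    ext k
    simp only [B, Matrix.vecMul, dotProduct, Pi.one_apply, one_mul, Matrix.sub_apply,
      Matrix.smul_apply, Finset.sum_sub_distrib, smul_eq_mul, ← Finset.mul_sum, Z_col, Pi.smul_apply]
    simp [Matrix.one_apply]
  have h2 : Matrix.vecMul (Matrix.vecMul 1 (B σ x)) (Rm σ x) = 1 := by
    rw [Matrix.vecMul_vecMul, B_mul_Rm σ hx, Matrix.vecMul_one]
  rw [hB, Matrix.smul_vecMul] at h2
  have h3 := congrFun h2 i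
  simp only [Pi.smul_apply, Matrix.vecMul, dotProduct, Pi.one_apply, one_mul, smul_eq_mul] at h3
  simp only [Matrix.sub_apply, Finset.sum_sub_distrib]
  have h4 : ∑ j, (1 : Matrix α α ℝ) j i = 1 := by simp [Matrix.one_apply]
  rw [h4]
  field_simp
  linarith

lemma Rm_tr (σ : Equiv.Perm α) {x : ℝ} (hx : |x| < 1) : (Rm σ x - 1).trace = x * trN σ x := by
  have h2 : Rm σ x - 1 = x • (Z σ * Rm σ x) := by
    nth_rewrite 1 [Rm_eq σ hx]; simp
  rw [h2, Matrix.trace_smul, trN, smul_eq_mul]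

set_option linter.unusedVariables false in
lemma Z_Rm_diag (σ : Equiv.Perm α) {x : ℝ} (hx : |x| < 1) :
    ∑ i, Z σ i i * (Rm σ x - 1) i i = (Z σ).trace * (x / (1 - x)) := by
  have h1 : (1 : ℝ) - x ≠ 0 := by have := (abs_lt.1 hx).2; linarith
  rw [Matrix.trace, Finset.sum_mul]
  refine Finset.sum_congr rfl fun i _ => ?_
  rw [Matrix.diag_apply]
  by_cases h : i = σ i
  · congr 1
    have hp : per σ i = 1 := Function.minimalPeriod_eq_one_iff_isFixedPt.2 h.symm
    simp [Rm, hp]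
    field_simp
    ring
  · simp [Z_apply, h]

lemma Z_Rm_ij (σ : Equiv.Perm α) {x : ℝ} (hx : |x| < 1) :
    ∑ i, ∑ j, Z σ i j * (Rm σ x - 1) i j = x * (Fintype.card α + x * trN σ x) := by
  have h2 : Rm σ x - 1 = x • (Z σ * Rm σ x) := by
    nth_rewrite 1 [Rm_eq σ hx]; simp
  have h3 : (Rm σ x).trace = Fintype.card α + x * trN σ x := by
    rw [← Rm_tr σ hx, Matrix.trace_sub, Matrix.trace_one]; ring
  rw [← h3, h2, Finset.sum_comm, Matrix.trace, Finset.mul_sum]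
  refine Finset.sum_congr rfl fun j _ => ?_
  simp only [Matrix.smul_apply, Z_mul_apply, Z_apply, ite_mul, one_mul, zero_mul, smul_eq_mul]
  simp

lemma Z_Rm_ji (σ : Equiv.Perm α) {x : ℝ} (hx : |x| < 1) :
    ∑ i, ∑ j, Z σ i j * (Rm σ x - 1) j i = trN σ x - (Z σ).trace := by
  have : ∑ i, ∑ j, Z σ i j * (Rm σ x - 1) j i = (Z σ * (Rm σ x - 1)).trace := by
    simp only [Matrix.trace, Matrix.diag_apply, Matrix.mul_apply]
  rw [this, Matrix.mul_sub, Matrix.mul_one, Matrix.trace_sub, trN]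

lemma sum_pd_swap (σ : Equiv.Perm α) {x : ℝ} (hx : |x| < 1) :
    ∑ i, ∑ j, pd (σ * Equiv.swap i j) x = pd σ x * ((Fintype.card α : ℝ) ^ 2 +
      2 * Fintype.card α * (x * trN σ x) - 2 * Fintype.card α * (x / (1 - x))) := by
  simp only [pd_swap σ hx, ← Finset.mul_sum, Finset.sum_add_distrib, sum_qf, Rm_tr σ hx,
    Rm_row σ hx, Finset.sum_const, Finset.card_univ, nsmul_eq_mul]
  ring

/-- the generating function of the near-hook characters -/
noncomputable def W (σ : Equiv.Perm α) (x : ℝ) : ℝ :=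
  pd σ x * (1 + x / (1 - x) ^ 2 * (Z σ).trace)

/-- its derivative -/
noncomputable def W' (σ : Equiv.Perm α) (x : ℝ) : ℝ :=
  -(pd σ x * trN σ x) * (1 + x / (1 - x) ^ 2 * (Z σ).trace)
    + pd σ x * ((1 + x) / (1 - x) ^ 3 * (Z σ).trace)

lemma W_deriv (σ : Equiv.Perm α) {x : ℝ} (hx : |x| < 1) : HasDerivAt (W σ) (W' σ x) x := by
  have h1 : (1 : ℝ) - x ≠ 0 := by have := (abs_lt.1 hx).2; linarith
  have h2 : HasDerivAt (fun x : ℝ => x / (1 - x) ^ 2) ((1 + x) / (1 - x) ^ 3) x := by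
    have := (hasDerivAt_id' x).div (((hasDerivAt_id' x).const_sub 1).pow 2) (pow_ne_zero 2 h1)
    refine this.congr_deriv ?_
    simp
    field_simp
    ring
  exact (pd_deriv σ hx).mul ((h2.mul_const _).const_add 1)

lemma sum_W_swap (σ : Equiv.Perm α) {x : ℝ} (hx : |x| < 1) :
    ∑ i, ∑ j, W (σ * Equiv.swap i j) x = (Fintype.card α : ℝ) ^ 2 * W σ x
      - 2 * (Fintype.card α - 1) * x * W' σ x := by
  have h1 : (1 : ℝ) - x ≠ 0 := by have := (abs_lt.1 hx).2; linarith
  have e : ∀ i j, W (σ * Equiv.swap i j) x = pd σ x *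
      ((1 + x / (1 - x) ^ 2 * (Z σ).trace) + (1 + x / (1 - x) ^ 2 * (Z σ).trace) * qf (Rm σ x - 1) i j
        - x / (1 - x) ^ 2 * qf (Z σ) i j
        - x / (1 - x) ^ 2 * (qf (Z σ) i j * qf (Rm σ x - 1) i j)) := by
    intro i j
    rw [W, pd_swap σ hx, tr_swap]; ring
  simp only [e, ← Finset.mul_sum, Finset.sum_sub_distrib, Finset.sum_add_distrib, sum_qf,
    sum_qf_qf (Z σ) (Rm σ x - 1) 1 (x / (1 - x)) (Z_row σ) (Z_col σ) (Rm_row σ hx) (Rm_col σ hx),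
    Rm_tr σ hx, Z_Rm_diag σ hx, Z_Rm_ij σ hx, Z_Rm_ji σ hx, Rm_row σ hx, Z_row,
    Finset.sum_const, Finset.card_univ, nsmul_eq_mul]
  rw [W, W']
  field_simp
  ring

/-- sum over the group of `det(1-xσ)` -/
lemma sum_pd {x : ℝ} (hα : 0 < Fintype.card α) (hx : 0 < x) (hx1 : x < 1) :
    ∑ σ : Equiv.Perm α, pd σ x = (Fintype.card α).factorial * (1 - x) := by
  have hN : (Fintype.card α : ℝ) ≠ 0 := by exact_mod_cast hα.ne'
  let S : ℝ → ℝ := fun x => ∑ σ : Equiv.Perm α, pd σ x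
  have hS : ∀ y, |y| < 1 → HasDerivAt S (∑ σ : Equiv.Perm α, -(pd σ y * trN σ y)) y := by
    intro y hy
    exact HasDerivAt.fun_sum fun σ _ => pd_deriv σ hy
  have key : ∀ y, |y| < 1 → y ≠ 0 → ∑ σ : Equiv.Perm α, -(pd σ y * trN σ y) = - (S y / (1 - y)) := by
    intro y hy hy0
    have h1 : (1 : ℝ) - y ≠ 0 := by have := (abs_lt.1 hy).2; linarith
    have e1 : ∑ σ : Equiv.Perm α, ∑ i, ∑ j, pd (σ * Equiv.swap i j) y = (Fintype.card α : ℝ) ^ 2 * S y := by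
      rw [Finset.sum_comm]
      have : ∀ i : α, ∑ σ : Equiv.Perm α, ∑ j, pd (σ * Equiv.swap i j) y = Fintype.card α * S y := by
        intro i
        rw [Finset.sum_comm]
        have : ∀ j : α, ∑ σ : Equiv.Perm α, pd (σ * Equiv.swap i j) y = S y := by
          intro j
          exact Equiv.sum_comp (Equiv.mulRight (Equiv.swap i j)) (fun σ => pd σ y)
        simp [this]
      simp [this]; ring
    simp only [sum_pd_swap _ hy] at e1
    have e2 : ∑ σ : Equiv.Perm α, pd σ y * ((Fintype.card α : ℝ) ^ 2 +
      2 * Fintype.card α * (y * trN σ y) - 2 * Fintype.card α * (y / (1 - y))) =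
        ((Fintype.card α : ℝ) ^ 2 - 2 * Fintype.card α * (y / (1 - y))) * S y +
        2 * Fintype.card α * y * ∑ σ : Equiv.Perm α, (pd σ y * trN σ y) := by
      simp only [S, Finset.mul_sum, ← Finset.sum_add_distrib]
      refine Finset.sum_congr rfl fun σ _ => ?_
      ring
    rw [e2] at e1
    rw [Finset.sum_neg_distrib, neg_inj]
    have e3 : (2 * Fintype.card α * y) * (∑ σ : Equiv.Perm α, (pd σ y * trN σ y) - S y / (1 - y)) = 0 := by
      linear_combination e1
    have := (mul_eq_zero.1 e3).resolve_left (by positivity)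
    linarith
  have hd : ∀ y, |y| < 1 → HasDerivAt (fun y => S y / (1 - y))
      (((∑ σ : Equiv.Perm α, -(pd σ y * trN σ y)) * (1 - y) - S y * (-1)) / (1 - y) ^ 2) y := by
    intro y hy
    have h1 : (1 : ℝ) - y ≠ 0 := by have := (abs_lt.1 hy).2; linarith
    exact (hS y hy).div ((hasDerivAt_id' y).const_sub 1) h1
  obtain ⟨ξ, hξ, he⟩ := exists_hasDerivAt_eq_slope (fun y => S y / (1 - y)) _ hx
    (fun y hy => (hd y (abs_lt.2 ⟨by linarith [hy.1], by linarith [hy.2]⟩)).continuousAt.continuousWithinAt)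
    (fun y hy => hd y (abs_lt.2 ⟨by linarith [hy.1], by linarith [hy.2]⟩))
  have hξ1 : (1 : ℝ) - ξ ≠ 0 := by linarith [hξ.2]
  rw [key ξ (abs_lt.2 ⟨by linarith [hξ.1], by linarith [hξ.2]⟩) hξ.1.ne'] at he
  have h0 : S 0 = (Fintype.card α).factorial := by
    simp [S, pd_zero, Fintype.card_perm]
  have hz : (-(S ξ / (1 - ξ)) * (1 - ξ) - S ξ * -1) / (1 - ξ) ^ 2 = 0 := by
    field_simp; ring
  rw [hz, h0] at he
  have h1 : (1 : ℝ) - x ≠ 0 := by linarith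
  have hxx : x ≠ 0 := hx.ne'
  have : S x / (1 - x) = (Fintype.card α).factorial := by
    simp only [sub_zero, div_one] at he
    have := (div_eq_zero_iff.1 he.symm).resolve_right hxx
    linarith
  rw [div_eq_iff h1] at this
  exact this

end mat2
end CW

namespace CW
section lim
set_option linter.unusedSectionVars false
variable {α : Type*} [Fintype α] [DecidableEq α]

/-- the class of `(n-1)`-cycles -/
def NC (σ : Equiv.Perm α) : Prop := σ.IsCycle ∧ σ.support.card = Fintype.card α - 1

lemma NC_fix {σ : Equiv.Perm α} (h : NC σ) (hα : 3 ≤ Fintype.card α) :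
    ∃ i0, σ i0 = i0 ∧ ∀ i, i ≠ i0 → per σ i = Fintype.card α - 1 := by
  have h1 : (univ \ σ.support).card = 1 := by
    rw [Finset.card_sdiff_of_subset (Finset.subset_univ _), h.2, Finset.card_univ]; omega
  obtain ⟨i0, hi0⟩ := Finset.card_eq_one.1 h1
  have hm : ∀ i, i ∉ σ.support ↔ i = i0 := by
    intro i
    have := Finset.ext_iff.1 hi0 i
    simpa using this
  refine ⟨i0, by have := (hm i0).2 rfl; simpa using this, fun i hi => ?_⟩
  have hi' : σ i ≠ i := by
    have := (hm i).not.2 hi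
    simpa using this
  apply Nat.dvd_antisymm
  · rw [← per_dvd, ← h.2, ← h.1.orderOf, pow_orderOf_eq_one]; rfl
  · rw [← h.2, ← h.1.orderOf, orderOf_dvd_iff_pow_eq_one, h.1.pow_eq_one_iff]
    exact ⟨i, hi', pow_per σ i⟩

lemma tr_eq (σ : Equiv.Perm α) : (Z σ).trace = ((univ.filter fun i => σ i = i).card : ℝ) := by
  simp [Matrix.trace, Z_apply, eq_comm]

lemma NC_tr {σ : Equiv.Perm α} (h : NC σ) (hα : 3 ≤ Fintype.card α) : (Z σ).trace = 1 := by
  obtain ⟨i0, h0, h1⟩ := NC_fix h hα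
  rw [tr_eq]
  have : (univ.filter fun i => σ i = i) = {i0} := by
    ext i
    simp only [mem_filter, mem_univ, true_and, mem_singleton]
    constructor
    · intro hi
      by_contra hne
      have := h1 i hne
      have h2 : per σ i = 1 := Function.minimalPeriod_eq_one_iff_isFixedPt.2 hi
      omega
    · rintro rfl; exact h0
  rw [this]; simp

lemma NC_pd {σ : Equiv.Perm α} (h : NC σ) (hα : 3 ≤ Fintype.card α) {x : ℝ} (hx : 0 ≤ x) (hx1 : x < 1) :
    pd σ x = (1 - x) * (1 - x ^ (Fintype.card α - 1)) := by
  obtain ⟨i0, h0, h1⟩ := NC_fix h hα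
  have hax : |x| < 1 := abs_lt.2 ⟨by linarith, hx1⟩
  rw [pd_eq_exp σ hx hx1, lp, ← Finset.add_sum_erase _ _ (Finset.mem_univ i0)]
  have hp : per σ i0 = 1 := Function.minimalPeriod_eq_one_iff_isFixedPt.2 h0
  have e : ∑ i ∈ univ.erase i0, 1 / (per σ i : ℝ) * Real.log (1 - x ^ per σ i)
      = Real.log (1 - x ^ (Fintype.card α - 1)) := by
    rw [Finset.sum_congr rfl (g := fun _ => 1 / ((Fintype.card α - 1 : ℕ) : ℝ) *
      Real.log (1 - x ^ (Fintype.card α - 1))) (fun i hi => by rw [h1 i (Finset.ne_of_mem_erase hi)])]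
    rw [Finset.sum_const, Finset.card_erase_of_mem (Finset.mem_univ _), Finset.card_univ, nsmul_eq_mul,
      ← mul_assoc, mul_one_div_cancel, one_mul]
    have : 0 < Fintype.card α - 1 := by omega
    exact_mod_cast this.ne'
  rw [e, hp, Real.exp_add, Real.exp_log (one_sub_pow_pos hax (by omega))]
  simp only [Nat.cast_one, div_one, one_mul, pow_one]
  rw [Real.exp_log (by linarith)]

lemma NC_W {σ : Equiv.Perm α} (h : NC σ) (hα : 3 ≤ Fintype.card α) {x : ℝ} (hx : 0 ≤ x) (hx1 : x < 1) :
    W σ x = ∑ k ∈ range (Fintype.card α + 1), x ^ k - x - x ^ (Fintype.card α - 1) := by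
  have h1 : (1:ℝ) - x ≠ 0 := by linarith
  have h2 : x - 1 ≠ 0 := by linarith
  rw [W, NC_tr h hα, NC_pd h hα hx hx1, geom_sum_eq (by linarith)]
  obtain ⟨m, hm⟩ : ∃ m, Fintype.card α = m + 1 := ⟨Fintype.card α - 1, by omega⟩
  rw [hm]
  simp only [Nat.add_sub_cancel]
  field_simp
  ring

/-- the orbit of `i` as a finset -/
noncomputable def orb (σ : Equiv.Perm α) (i : α) : Finset α :=
  (range (per σ i)).image fun m => (σ ^ m) i

lemma orb_card (σ : Equiv.Perm α) (i : α) : (orb σ i).card = per σ i := by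
  rw [orb, Finset.card_image_of_injOn, Finset.card_range]
  intro a ha b hb hab
  have ha' := Finset.mem_range.1 ha
  have hb' := Finset.mem_range.1 hb
  simp only [Equiv.Perm.coe_pow] at hab
  exact Function.iterate_injOn_Iio_minimalPeriod ha' hb' hab

lemma orb_sub (σ : Equiv.Perm α) {i i0 : α} (h0 : σ i0 = i0) (hi : i ≠ i0) :
    orb σ i ⊆ univ.erase i0 := by
  intro y hy
  obtain ⟨m, _, rfl⟩ := Finset.mem_image.1 hy
  refine Finset.mem_erase.2 ⟨?_, Finset.mem_univ _⟩
  intro hc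
  have : (σ ^ m) i0 = i0 := Function.IsFixedPt.perm_pow h0 m
  exact hi ((σ ^ m).injective (hc.trans this.symm))

lemma per_le (σ : Equiv.Perm α) {i i0 : α} (h0 : σ i0 = i0) (hi : i ≠ i0) :
    per σ i ≤ Fintype.card α - 1 := by
  rw [← orb_card, ← Finset.card_univ, ← Finset.card_erase_of_mem (Finset.mem_univ i0)]
  exact Finset.card_le_card (orb_sub σ h0 hi)

lemma NC_of (σ : Equiv.Perm α) (hα : 3 ≤ Fintype.card α) {i0 : α} (h0 : σ i0 = i0)
    (h : ∀ i, i ≠ i0 → per σ i = Fintype.card α - 1) : NC σ := by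
  have hs : ∀ i, i ≠ i0 → σ i ≠ i := by
    intro i hi hc
    have h2 : per σ i = 1 := Function.minimalPeriod_eq_one_iff_isFixedPt.2 hc
    have := h i hi
    omega
  obtain ⟨i, hi⟩ : ∃ i, i ≠ i0 := by
    apply Fintype.exists_ne_of_one_lt_card
    omega
  have ho : orb σ i = univ.erase i0 := by
    apply Finset.eq_of_subset_of_card_le (orb_sub σ h0 hi)
    rw [orb_card, h i hi, Finset.card_erase_of_mem (Finset.mem_univ i0), Finset.card_univ]
  constructor
  · refine ⟨i, hs i hi, fun y hy => ?_⟩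
    have hy0 : y ≠ i0 := by rintro rfl; exact hy h0
    have : y ∈ orb σ i := by rw [ho]; simp [hy0]
    obtain ⟨m, _, hm⟩ := Finset.mem_image.1 this
    exact ⟨m, by simpa using hm⟩
  · have : σ.support = univ.erase i0 := by
      ext y
      simp only [Equiv.Perm.mem_support, mem_erase, mem_univ, and_true]
      exact ⟨by rintro h1 rfl; exact h1 h0, hs y⟩
    rw [this, Finset.card_erase_of_mem (Finset.mem_univ i0), Finset.card_univ]

/-- the number of cycles -/
noncomputable def kap (σ : Equiv.Perm α) : ℝ := ∑ i, 1 / (per σ i : ℝ)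

lemma kap_gt (σ : Equiv.Perm α) (hα : 3 ≤ Fintype.card α) {i0 : α} (h0 : σ i0 = i0) (h : ¬ NC σ) :
    2 < kap σ := by
  have hp : per σ i0 = 1 := Function.minimalPeriod_eq_one_iff_isFixedPt.2 h0
  rw [kap, ← Finset.add_sum_erase _ _ (Finset.mem_univ i0), hp]
  have hn : (0:ℝ) < ((Fintype.card α - 1 : ℕ) : ℝ) := by
    have : 0 < Fintype.card α - 1 := by omega
    exact_mod_cast this
  have : ∑ i ∈ univ.erase i0, 1 / ((Fintype.card α - 1 : ℕ) : ℝ) < ∑ i ∈ univ.erase i0, 1 / (per σ i : ℝ) := by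
    apply Finset.sum_lt_sum
    · intro i hi
      apply one_div_le_one_div_of_le
      · exact_mod_cast per_pos σ i
      · exact_mod_cast per_le σ h0 (Finset.ne_of_mem_erase hi)
    · by_contra hc
      push Not at hc
      apply h
      apply NC_of σ hα h0
      intro i hi
      apply le_antisymm (per_le σ h0 hi)
      have h1 := hc i (Finset.mem_erase.2 ⟨hi, Finset.mem_univ _⟩)
      have h2 : (0:ℝ) < per σ i := by exact_mod_cast per_pos σ i
      have := (one_div_le_one_div h2 hn).1 h1
      exact_mod_cast this
  rw [Finset.sum_const, Finset.card_erase_of_mem (Finset.mem_univ i0), Finset.card_univ, nsmul_eq_mul,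
    mul_one_div_cancel hn.ne'] at this
  simp only [Nat.cast_one, div_one]
  linarith

lemma pd_le (σ : Equiv.Perm α) : ∃ C : ℝ, ∀ x : ℝ, 0 < x → x < 1 →
    0 ≤ pd σ x ∧ pd σ x ≤ C * (1 - x) ^ (kap σ) := by
  refine ⟨Real.exp (∑ i, 1 / (per σ i : ℝ) * Real.log (per σ i)), fun x hx hx1 => ?_⟩
  rw [pd_eq_exp σ hx.le hx1]
  refine ⟨(Real.exp_pos _).le, ?_⟩
  have h1 : 0 < 1 - x := by linarith
  rw [Real.rpow_def_of_pos h1, ← Real.exp_add]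
  apply Real.exp_le_exp.2
  rw [lp, kap, Finset.mul_sum, ← Finset.sum_add_distrib]
  refine Finset.sum_le_sum fun i _ => ?_
  have hp : (0:ℝ) < per σ i := by exact_mod_cast per_pos σ i
  have hb : 1 - x ^ per σ i ≤ per σ i * (1 - x) := by
    have := one_add_mul_le_pow (a := x - 1) (by linarith) (per σ i)
    rw [add_sub_cancel] at this
    linarith
  have h2 : Real.log (1 - x ^ per σ i) ≤ Real.log (per σ i) + Real.log (1 - x) := by
    rw [← Real.log_mul hp.ne' h1.ne']
    exact Real.log_le_log (one_sub_pow_pos (abs_lt.2 ⟨by linarith, hx1⟩) (per_pos σ i)) hb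
  have h3 : (0:ℝ) ≤ 1 / per σ i := by positivity
  nlinarith [mul_le_mul_of_nonneg_left h2 h3]

lemma tendsto_rpow_one {κ : ℝ} (hκ : 0 < κ) :
    Tendsto (fun x : ℝ => (1 - x) ^ κ) (nhdsWithin 1 (Set.Iio 1)) (nhds 0) := by
  have : Continuous (fun x : ℝ => (1 - x) ^ κ) :=
    (continuous_const.sub continuous_id).rpow_const (fun _ => Or.inr hκ.le)
  have h := this.tendsto 1
  rw [sub_self, Real.zero_rpow hκ.ne'] at h
  exact h.mono_left nhdsWithin_le_nhds

lemma ev_Ioo : ∀ᶠ x : ℝ in nhdsWithin 1 (Set.Iio 1), 0 < x ∧ x < 1 := by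
  have := Ioo_mem_nhdsLT (show (0:ℝ) < 1 by norm_num)
  filter_upwards [this] with x hx using hx

lemma W_lim (σ : Equiv.Perm α) (hα : 3 ≤ Fintype.card α) (h : ¬ NC σ) :
    Tendsto (W σ) (nhdsWithin 1 (Set.Iio 1)) (nhds 0) := by
  obtain ⟨C, hC⟩ := pd_le σ
  have hk : 0 < kap σ := by
    apply Finset.sum_pos
    · intro i _
      have : (0:ℝ) < per σ i := by exact_mod_cast per_pos σ i
      positivity
    · rw [← Finset.card_pos, Finset.card_univ]; omega
  have h1 : Tendsto (pd σ) (nhdsWithin 1 (Set.Iio 1)) (nhds 0) := by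
    refine squeeze_zero' (g := fun x => C * (1 - x) ^ kap σ) ?_ ?_ ?_
    · filter_upwards [ev_Ioo] with x hx using (hC x hx.1 hx.2).1
    · filter_upwards [ev_Ioo] with x hx using (hC x hx.1 hx.2).2
    · simpa using (tendsto_rpow_one hk).const_mul C
  by_cases hf : ∃ i0, σ i0 = i0
  · obtain ⟨i0, h0⟩ := hf
    have h2 := kap_gt σ hα h0 h
    have h3 : Tendsto (fun x => pd σ x / (1 - x) ^ 2) (nhdsWithin 1 (Set.Iio 1)) (nhds 0) := by
      refine squeeze_zero' (g := fun x => C * (1 - x) ^ (kap σ - 2)) ?_ ?_ ?_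
      · filter_upwards [ev_Ioo] with x hx
        have := (hC x hx.1 hx.2).1
        positivity
      · filter_upwards [ev_Ioo] with x hx
        have h5 : 0 < 1 - x := by linarith [hx.2]
        rw [Real.rpow_sub h5, div_le_iff₀ (by positivity), mul_div_assoc', Real.rpow_two,
          div_mul_cancel₀ _ (by positivity)]
        exact (hC x hx.1 hx.2).2
      · simpa using (tendsto_rpow_one (show 0 < kap σ - 2 by linarith)).const_mul C
    have hx : Tendsto (fun x : ℝ => x) (nhdsWithin 1 (Set.Iio 1)) (nhds 1) :=
      tendsto_id.mono_left nhdsWithin_le_nhds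
    have h4 := h1.add ((h3.mul hx).mul_const (Z σ).trace)
    simp only [zero_mul, add_zero] at h4
    refine h4.congr fun x => ?_
    rw [W]; ring
  · have : (Z σ).trace = 0 := by
      rw [tr_eq]
      push Not at hf
      simp [hf]
    refine h1.congr fun x => ?_
    rw [W, this]; ring

lemma W_lim' (σ : Equiv.Perm α) (hα : 3 ≤ Fintype.card α) (h : NC σ) :
    Tendsto (W σ) (nhdsWithin 1 (Set.Iio 1)) (nhds ((Fintype.card α : ℝ) - 1)) := by
  have hc : Continuous (fun x : ℝ => ∑ k ∈ range (Fintype.card α + 1), x ^ k - x - x ^ (Fintype.card α - 1)) := by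
    fun_prop
  have h1 := (hc.tendsto 1).mono_left (nhdsWithin_le_nhds (s := Set.Iio 1))
  have e : ∑ k ∈ range (Fintype.card α + 1), (1:ℝ) ^ k - 1 - 1 ^ (Fintype.card α - 1) = (Fintype.card α : ℝ) - 1 := by
    simp
  rw [e] at h1
  refine h1.congr' ?_
  filter_upwards [ev_Ioo] with x hx
  exact (NC_W h hα hx.1.le hx.2).symm

/-- transposition-walk operator -/
noncomputable def Aop (f : Equiv.Perm α → ℝ) : Equiv.Perm α → ℝ := fun σ =>
  (∑ i, ∑ j, f (σ * Equiv.swap i j) - Fintype.card α * f σ) /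
    ((Fintype.card α : ℝ) * (Fintype.card α - 1))

lemma Aop_adj (f g : Equiv.Perm α → ℝ) : ∑ σ, Aop f σ * g σ = ∑ σ, f σ * Aop g σ := by
  simp only [Aop, div_mul_eq_mul_div, mul_div_assoc', ← Finset.sum_div]
  congr 1
  simp only [sub_mul, mul_sub, Finset.sum_sub_distrib, Finset.sum_mul, Finset.mul_sum]
  congr 1
  · rw [Finset.sum_comm, Finset.sum_comm (s := univ (α := Equiv.Perm α))]
    refine Finset.sum_congr rfl fun i _ => ?_
    rw [Finset.sum_comm, Finset.sum_comm (s := univ (α := Equiv.Perm α))]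
    refine Finset.sum_congr rfl fun j _ => ?_
    rw [← Equiv.sum_comp (Equiv.mulRight (Equiv.swap i j))]
    simp [mul_assoc]
  · exact Finset.sum_congr rfl fun σ _ => by ring

lemma Aop_W (hα : 3 ≤ Fintype.card α) (σ : Equiv.Perm α) {x : ℝ} (hx : |x| < 1) :
    Aop (fun σ => W σ x) σ = W σ x - 2 / Fintype.card α * x * W' σ x := by
  have h3 : (3:ℝ) ≤ Fintype.card α := by exact_mod_cast hα
  have h1 : (Fintype.card α : ℝ) ≠ 0 := by linarith
  have h2 : (Fintype.card α : ℝ) - 1 ≠ 0 := by linarith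
  rw [Aop, sum_W_swap σ hx]
  field_simp
  ring

lemma spec_aux (hα : 3 ≤ Fintype.card α) (h : Equiv.Perm α → ℝ) (K : ℕ) (c : ℕ → ℝ)
    (H : ∀ x : ℝ, 0 < x → x < 1 → ∑ σ, h σ * W σ x = ∑ k ∈ range K, c k * x ^ k) (t : ℕ) :
    ∀ x : ℝ, 0 < x → x < 1 → ∑ σ, (Aop^[t] h) σ * W σ x =
      ∑ k ∈ range K, c k * (1 - 2 * k / Fintype.card α) ^ t * x ^ k := by
  induction t with
  | zero => simpa using H
  | succ t ih =>
    intro x hx hx1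
    have hax : |x| < 1 := abs_lt.2 ⟨by linarith, hx1⟩
    have d1 : HasDerivAt (fun x => ∑ σ, (Aop^[t] h) σ * W σ x) (∑ σ, (Aop^[t] h) σ * W' σ x) x :=
      HasDerivAt.fun_sum fun σ _ => (W_deriv σ hax).const_mul _
    have d2 : HasDerivAt (fun x : ℝ => ∑ k ∈ range K, c k * (1 - 2 * k / Fintype.card α) ^ t * x ^ k)
        (∑ k ∈ range K, c k * (1 - 2 * k / Fintype.card α) ^ t * (k * x ^ (k - 1))) x :=
      HasDerivAt.fun_sum fun k _ => (hasDerivAt_pow k x).const_mul _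
    have d3 : ∑ σ, (Aop^[t] h) σ * W' σ x =
        ∑ k ∈ range K, c k * (1 - 2 * k / Fintype.card α) ^ t * (k * x ^ (k - 1)) := by
      refine d1.unique (d2.congr_of_eventuallyEq ?_)
      filter_upwards [Ioo_mem_nhds hx hx1] with y hy
      exact ih y hy.1 hy.2
    rw [Function.iterate_succ_apply', Aop_adj]
    simp only [Aop_W hα _ hax, mul_sub, Finset.sum_sub_distrib]
    rw [ih x hx hx1]
    have e : ∑ σ, (Aop^[t] h) σ * (2 / Fintype.card α * x * W' σ x) =
        2 / Fintype.card α * x * ∑ σ, (Aop^[t] h) σ * W' σ x := by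
      rw [Finset.mul_sum]
      exact Finset.sum_congr rfl fun σ _ => by ring
    rw [e, d3, Finset.mul_sum, ← Finset.sum_sub_distrib]
    refine Finset.sum_congr rfl fun k _ => ?_
    rcases Nat.eq_zero_or_pos k with rfl | hk
    · simp
    · obtain ⟨m, rfl⟩ : ∃ m, k = m + 1 := ⟨k - 1, by omega⟩
      rw [Nat.add_sub_cancel, pow_succ, pow_succ]
      ring

open Classical in
lemma spec (hα : 3 ≤ Fintype.card α) (h : Equiv.Perm α → ℝ) (K : ℕ) (c : ℕ → ℝ)
    (H : ∀ x : ℝ, 0 < x → x < 1 → ∑ σ, h σ * W σ x = ∑ k ∈ range K, c k * x ^ k) (t : ℕ) :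
    ((Fintype.card α : ℝ) - 1) * ∑ σ ∈ univ.filter (fun σ : Equiv.Perm α => NC σ), (Aop^[t] h) σ =
      ∑ k ∈ range K, c k * (1 - 2 * k / Fintype.card α) ^ t := by
  have L1 : Tendsto (fun x => ∑ σ, (Aop^[t] h) σ * W σ x) (nhdsWithin 1 (Set.Iio 1))
      (nhds (∑ σ, (Aop^[t] h) σ * (if NC σ then (Fintype.card α : ℝ) - 1 else 0))) := by
    refine tendsto_finsetSum _ fun σ _ => Tendsto.const_mul _ ?_
    by_cases hσ : NC σ
    · rw [if_pos hσ]; exact W_lim' σ hα hσ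
    · rw [if_neg hσ]; exact W_lim σ hα hσ
  have hc : Continuous (fun x : ℝ => ∑ k ∈ range K, c k * (1 - 2 * k / Fintype.card α) ^ t * x ^ k) := by
    fun_prop
  have L2 := (hc.tendsto 1).mono_left (nhdsWithin_le_nhds (s := Set.Iio 1))
  have L3 := tendsto_nhds_unique L1 (L2.congr' (by
    filter_upwards [ev_Ioo] with x hx using (spec_aux hα h K c H t x hx.1 hx.2).symm))
  simp only [one_pow, mul_one] at L3
  rw [← L3, Finset.mul_sum, Finset.sum_filter]
  refine Finset.sum_congr rfl fun σ _ => ?_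
  split_ifs <;> ring

end lim
end CW

namespace CW
section mom
set_option linter.unusedSectionVars false
variable {α : Type*} [Fintype α] [DecidableEq α]

/-- number of fixed points -/
def fx (σ : Equiv.Perm α) : ℕ := (univ.filter fun i => σ i = i).card

lemma sum_choose (j : ℕ) (Φ : Equiv.Perm α → ℝ) :
    ∑ σ, ((fx σ).choose j : ℝ) * Φ σ =
      ∑ A ∈ powersetCard j (univ : Finset α), ∑ ρ : Equiv.Perm {i // i ∉ A}, Φ (Equiv.Perm.ofSubtype ρ) := by
  have h1 : ∀ σ : Equiv.Perm α, ((fx σ).choose j : ℝ) =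
      ∑ A ∈ powersetCard j (univ : Finset α), if (∀ a, ¬ (a ∉ A) → σ a = a) then (1:ℝ) else 0 := by
    intro σ
    rw [fx, ← Finset.card_powersetCard, Finset.sum_boole]
    congr 2
    ext A
    simp only [mem_powersetCard, mem_filter, subset_univ, true_and, not_not]
    rw [and_comm]
    refine and_congr_right fun _ => ?_
    constructor
    · intro h a ha; have := h ha; simpa using this
    · intro h a ha; simpa using h a ha
  simp only [h1, Finset.sum_mul]
  rw [Finset.sum_comm]
  refine Finset.sum_congr rfl fun A _ => ?_
  simp only [ite_mul, one_mul, zero_mul]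
  rw [← Finset.sum_filter]
  rw [← Equiv.sum_comp (Equiv.Perm.subtypeEquivSubtypePerm (fun i => i ∉ A)).symm]
  rw [Finset.sum_subtype (p := fun f : Equiv.Perm α => ∀ a, ¬ (a ∉ A) → f a = a) _ (by simp)]
  refine Finset.sum_congr rfl fun f _ => ?_
  congr 1
  exact (congrArg Subtype.val ((Equiv.Perm.subtypeEquivSubtypePerm (fun i => i ∉ A)).apply_symm_apply f)).symm

lemma card_compl_sub (A : Finset α) : Fintype.card {i // i ∉ A} = Fintype.card α - A.card := by
  rw [Fintype.card_subtype_compl]; simp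

lemma pd_ofSubtype (A : Finset α) (ρ : Equiv.Perm {i // i ∉ A}) {x : ℝ} (hx : 0 ≤ x) (hx1 : x < 1) :
    pd (Equiv.Perm.ofSubtype ρ) x = (1 - x) ^ A.card * pd ρ x := by
  have h1 : 0 < 1 - x := by linarith
  rw [pd_eq_exp _ hx hx1, pd_eq_exp _ hx hx1]
  have e : lp (Equiv.Perm.ofSubtype ρ) x = A.card * Real.log (1 - x) + lp ρ x := by
    rw [lp, ← Fintype.sum_subtype_add_sum_subtype (fun i => i ∉ A), add_comm]
    congr 1
    · have : ∀ i : {i // ¬ i ∉ A}, 1 / (per (Equiv.Perm.ofSubtype ρ) (i : α) : ℝ) *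
          Real.log (1 - x ^ per (Equiv.Perm.ofSubtype ρ) (i : α)) = Real.log (1 - x) := by
        intro i
        have : per (Equiv.Perm.ofSubtype ρ) (i : α) = 1 :=
          Function.minimalPeriod_eq_one_iff_isFixedPt.2 (Equiv.Perm.ofSubtype_apply_of_not_mem ρ i.2)
        rw [this]; simp
      rw [Finset.sum_congr rfl fun i _ => this i, Finset.sum_const, nsmul_eq_mul, Finset.card_univ]
      congr 2
      simp
    · rw [lp]
      refine Finset.sum_congr rfl fun i _ => ?_
      have : per (Equiv.Perm.ofSubtype ρ) (i : α) = per ρ i := by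
        have h : ∀ m, per (Equiv.Perm.ofSubtype ρ) (i : α) ∣ m ↔ per ρ i ∣ m := by
          intro m
          rw [← per_dvd, ← per_dvd, ← map_pow, Equiv.Perm.ofSubtype_apply_coe]
          exact Subtype.ext_iff.symm
        exact Nat.dvd_antisymm ((h _).2 dvd_rfl) ((h _).1 dvd_rfl)
      rw [this]
  rw [e, Real.exp_add, Real.exp_nat_mul, Real.exp_log h1]

lemma sum_choose_pd (j : ℕ) (hj : j < Fintype.card α) {x : ℝ} (hx : 0 < x) (hx1 : x < 1) :
    ∑ σ : Equiv.Perm α, ((fx σ).choose j : ℝ) * pd σ x =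
      (Fintype.card α).factorial / j.factorial * (1 - x) ^ (j + 1) := by
  rw [sum_choose]
  have : ∀ A ∈ powersetCard j (univ : Finset α), ∑ ρ : Equiv.Perm {i // i ∉ A}, pd (Equiv.Perm.ofSubtype ρ) x
      = (1 - x) ^ (j + 1) * (Fintype.card α - j).factorial := by
    intro A hA
    have hc := (mem_powersetCard.1 hA).2
    simp only [pd_ofSubtype A _ hx.le hx1, ← Finset.mul_sum]
    rw [sum_pd (by rw [card_compl_sub]; omega) hx hx1, card_compl_sub, hc]
    ring
  rw [Finset.sum_congr rfl this, Finset.sum_const, Finset.card_powersetCard, Finset.card_univ, nsmul_eq_mul]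
  have h2 : ((Fintype.card α).choose j : ℝ) * j.factorial * (Fintype.card α - j).factorial = (Fintype.card α).factorial := by
    exact_mod_cast Nat.choose_mul_factorial_mul_factorial hj.le
  have h3 : (j.factorial : ℝ) ≠ 0 := by positivity
  rw [← h2]
  field_simp

lemma choose_mul (f j : ℕ) : (f.choose j : ℝ) * f = j * f.choose j + (j + 1) * f.choose (j + 1) := by
  have h := Nat.choose_succ_right_eq f j
  rcases le_or_gt j f with hj | hj
  · have h2 : (f.choose (j + 1) : ℝ) * (j + 1) = f.choose j * (f - j) := by
      rw [← Nat.cast_sub hj]; exact_mod_cast h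
    linear_combination -h2
  · rw [Nat.choose_eq_zero_of_lt hj, Nat.choose_eq_zero_of_lt (by omega)]; simp

/-- coefficient sequence -/
noncomputable def cf (j k : ℕ) : ℝ := (1 - k) * (-1) ^ k * j.choose k

lemma cf_sum (j : ℕ) (x : ℝ) :
    ∑ k ∈ range (j + 1), cf j k * x ^ k = (1 - x) ^ j + j * x * (1 - x) ^ (j - 1) := by
  have h1 : ∀ (j : ℕ) (x : ℝ), ∑ k ∈ range (j + 1), x ^ k * (-1) ^ k * j.choose k = (1 - x) ^ j := by
    intro j x
    have := add_pow (-x) 1 j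
    rw [neg_add_eq_sub] at this
    rw [this]
    refine Finset.sum_congr rfl fun k _ => ?_
    rw [neg_pow]; ring
  have h2 : ∑ k ∈ range (j + 1), (k:ℝ) * (x ^ k * (-1) ^ k * j.choose k) = - (j * x * (1 - x) ^ (j - 1)) := by
    rcases j with _ | j
    · simp
    · rw [Finset.sum_range_succ']
      simp only [Nat.add_sub_cancel]
      rw [← h1 j x, Finset.mul_sum]
      simp only [Nat.cast_zero, zero_mul, add_zero]
      rw [← Finset.sum_neg_distrib]
      refine Finset.sum_congr rfl fun k _ => ?_
      have : ((j + 1).choose (k + 1) : ℝ) * (k + 1) = (j + 1) * j.choose k := by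
        have := Nat.add_one_mul_choose_eq j k
        exact_mod_cast this.symm
      push_cast
      linear_combination x ^ (k + 1) * (-1) ^ (k + 1) * this
  have : ∀ k, cf j k * x ^ k = x ^ k * (-1) ^ k * j.choose k - k * (x ^ k * (-1) ^ k * j.choose k) := by
    intro k; rw [cf]; ring
  simp only [this, Finset.sum_sub_distrib, h1, h2]
  ring

lemma sum_choose_W (j : ℕ) (hj : j + 1 < Fintype.card α) {x : ℝ} (hx : 0 < x) (hx1 : x < 1) :
    ∑ σ : Equiv.Perm α, ((fx σ).choose j : ℝ) * W σ x =
      ∑ k ∈ range (j + 1), ((Fintype.card α).factorial / j.factorial * cf j k) * x ^ k := by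
  have e0 : ∀ k, ((Fintype.card α).factorial / j.factorial * cf j k) * x ^ k =
    (Fintype.card α).factorial / j.factorial * (cf j k * x ^ k) := fun k => by ring
  simp only [e0, ← Finset.mul_sum, cf_sum]
  have e : ∀ σ : Equiv.Perm α, ((fx σ).choose j : ℝ) * W σ x =
      (1 + x / (1 - x) ^ 2 * j) * (((fx σ).choose j : ℝ) * pd σ x) +
      (x / (1 - x) ^ 2 * (j + 1)) * (((fx σ).choose (j + 1) : ℝ) * pd σ x) := by
    intro σ
    rw [W, tr_eq]
    have := choose_mul (fx σ) j
    change ((fx σ).choose j : ℝ) * (pd σ x * (1 + x / (1 - x) ^ 2 * (fx σ : ℝ))) = _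
    linear_combination pd σ x * (x / (1 - x) ^ 2) * this
  simp only [e, Finset.sum_add_distrib, ← Finset.mul_sum]
  rw [sum_choose_pd j (by omega) hx hx1, sum_choose_pd (j + 1) hj hx hx1]
  have h1 : 1 - x ≠ 0 := by linarith
  have h3 : (j.factorial : ℝ) ≠ 0 := by positivity
  have h4 : ((j:ℝ) + 1) ≠ 0 := by positivity
  rw [Nat.factorial_succ]
  push_cast
  rcases j with _ | j
  · field_simp; simp; ring
  · rw [Nat.add_sub_cancel]
    field_simp
    ring

lemma sum_choose_one (j : ℕ) (hj : j ≤ Fintype.card α) :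
    ∑ σ : Equiv.Perm α, ((fx σ).choose j : ℝ) = (Fintype.card α).factorial / j.factorial := by
  have := sum_choose (α := α) j (fun _ => 1)
  simp only [mul_one] at this
  rw [this]
  have : ∀ A ∈ powersetCard j (univ : Finset α), ∑ ρ : Equiv.Perm {i // i ∉ A}, (1:ℝ)
      = (Fintype.card α - j).factorial := by
    intro A hA
    have hc := (mem_powersetCard.1 hA).2
    rw [Finset.sum_const, Finset.card_univ, Fintype.card_perm, card_compl_sub, hc]; simp
  rw [Finset.sum_congr rfl this, Finset.sum_const, Finset.card_powersetCard, Finset.card_univ, nsmul_eq_mul]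
  have h2 : ((Fintype.card α).choose j : ℝ) * j.factorial * (Fintype.card α - j).factorial = (Fintype.card α).factorial := by
    exact_mod_cast Nat.choose_mul_factorial_mul_factorial hj
  have h3 : (j.factorial : ℝ) ≠ 0 := by positivity
  rw [← h2]
  field_simp

/-- real sign -/
noncomputable def sg (σ : Equiv.Perm α) : ℝ := ((Equiv.Perm.sign σ : ℤ) : ℝ)

lemma sg_swap (σ : Equiv.Perm α) {i j : α} (h : i ≠ j) : sg (σ * Equiv.swap i j) = - sg σ := by
  simp [sg, Equiv.Perm.sign_swap h]

lemma sg_cases (σ : Equiv.Perm α) : sg σ = 1 ∨ sg σ = -1 := by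
  rcases Int.units_eq_one_or (Equiv.Perm.sign σ) with h | h <;> simp [sg, h]

lemma sum_sg (h : 2 ≤ Fintype.card α) : ∑ σ : Equiv.Perm α, sg σ = 0 := by
  obtain ⟨i, j, hij⟩ := Fintype.exists_pair_of_one_lt_card (show 1 < Fintype.card α by omega)
  have h1 := Equiv.sum_comp (Equiv.mulRight (Equiv.swap i j)) (fun σ : Equiv.Perm α => sg σ)
  simp only [Equiv.coe_mulRight, sg_swap _ hij, Finset.sum_neg_distrib] at h1
  linarith

lemma sum_choose_sg (j : ℕ) (hj : j + 2 ≤ Fintype.card α) :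
    ∑ σ : Equiv.Perm α, ((fx σ).choose j : ℝ) * sg σ = 0 := by
  rw [sum_choose]
  refine Finset.sum_eq_zero fun A hA => ?_
  have hc := (mem_powersetCard.1 hA).2
  have : ∀ ρ : Equiv.Perm {i // i ∉ A}, sg (Equiv.Perm.ofSubtype ρ) = sg ρ := by
    intro ρ
    simp [sg, Equiv.Perm.sign_ofSubtype]
  simp only [this]
  exact sum_sg (by rw [card_compl_sub]; omega)

end mom
end CW

namespace CW
section wk

lemma mem_tr {n : ℕ} (σ : Equiv.Perm (Fin n)) : σ ∈ transpositions n ↔ σ.IsSwap := by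
  simp [transpositions]

lemma mem_cyc {n : ℕ} (σ : Equiv.Perm (Fin n)) : σ ∈ cycles n 1 ↔ NC σ := by
  simp [cycles, NC]

lemma fib_card {n : ℕ} (τ : Equiv.Perm (Fin n)) (h : τ ∈ transpositions n) :
    ((univ : Finset (Fin n)).offDiag.filter fun p => Equiv.swap p.1 p.2 = τ).card = 2 := by
  obtain ⟨a, b, hab, rfl⟩ := (mem_tr τ).1 h
  have : ((univ : Finset (Fin n)).offDiag.filter fun p => Equiv.swap p.1 p.2 = Equiv.swap a b)
      = {(a, b), (b, a)} := by
    ext ⟨i, j⟩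
    simp only [mem_filter, mem_offDiag, mem_univ, true_and, mem_insert, mem_singleton, Prod.mk.injEq]
    constructor
    · rintro ⟨hij, h⟩
      have h1 := congrArg (fun σ : Equiv.Perm (Fin n) => σ i) h
      simp only [Equiv.swap_apply_left] at h1
      rw [Equiv.swap_apply_def] at h1
      split_ifs at h1 with h2 h3
      · left; exact ⟨h2, h1⟩
      · right; exact ⟨h3, h1⟩
      · exact absurd h1.symm hij
    · rintro (⟨rfl, rfl⟩ | ⟨rfl, rfl⟩)
      · exact ⟨hab, rfl⟩
      · exact ⟨Ne.symm hab, Equiv.swap_comm _ _⟩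
  rw [this, Finset.card_pair]
  simp [hab]

lemma sum_tr {n : ℕ} (F : Equiv.Perm (Fin n) → ℝ) :
    ∑ i, ∑ j, F (Equiv.swap i j) = n * F 1 + 2 * ∑ τ ∈ transpositions n, F τ := by
  rw [← Finset.sum_product', ← Finset.diag_union_offDiag, Finset.sum_union (Finset.disjoint_diag_offDiag _)]
  congr 1
  · rw [Finset.sum_congr rfl (g := fun _ => F 1)]
    · simp
    · rintro ⟨i, j⟩ h
      simp at h
      subst h
      simp only [Equiv.swap_self]
      rfl
  · rw [← Finset.sum_fiberwise_of_maps_to (t := transpositions n) (g := fun p : Fin n × Fin n => Equiv.swap p.1 p.2),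
      Finset.mul_sum]
    · refine Finset.sum_congr rfl fun τ hτ => ?_
      rw [Finset.sum_congr rfl (g := fun _ => F τ), Finset.sum_const, fib_card τ hτ]
      · simp
      · intro p hp; rw [(mem_filter.1 hp).2]
    · intro p hp
      rw [mem_tr]
      exact ⟨p.1, p.2, (mem_offDiag.1 hp).2.2, rfl⟩

lemma card_tr (n : ℕ) : 2 * ((transpositions n).card : ℝ) = n * (n - 1) := by
  have := sum_tr (n := n) (fun _ => 1)
  simp at this
  linarith

lemma conv_tr {n : ℕ} (hn : 3 ≤ n) (f : Equiv.Perm (Fin n) → ℝ) : conv f (unifOn (transpositions n)) = Aop f := by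
  funext σ
  have h1 := card_tr n
  have h2 := sum_tr (n := n) (fun τ => f (σ * τ))
  have hn' : (3:ℝ) ≤ n := by exact_mod_cast hn
  simp only [mul_one] at h2
  rw [Aop, h2, conv]
  have e : ∑ h, f (σ * h⁻¹) * unifOn (transpositions n) h =
      (∑ τ ∈ transpositions n, f (σ * τ)) / (transpositions n).card := by
    rw [Finset.sum_div, ← Finset.sum_subset (Finset.subset_univ (transpositions n))]
    · refine Finset.sum_congr rfl fun τ hτ => ?_
      rw [unifOn, if_pos hτ]
      obtain ⟨a, b, hab, rfl⟩ := (mem_tr τ).1 hτ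
      rw [Equiv.swap_inv]; ring
    · intro τ _ hτ
      rw [unifOn, if_neg hτ, mul_zero]
  rw [e]
  have h3 : ((transpositions n).card : ℝ) = n * (n - 1) / 2 := by linarith
  rw [h3, Fintype.card_fin]
  have h4 : (n:ℝ) ≠ 0 := by linarith
  have h5 : (n:ℝ) - 1 ≠ 0 := by linarith
  field_simp
  ring

lemma conv_assoc' {n : ℕ} (f g h : Equiv.Perm (Fin n) → ℝ) : conv f (conv g h) = conv (conv f g) h := by
  funext σ
  simp only [conv, Finset.mul_sum, Finset.sum_mul]
  rw [Finset.sum_comm]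
  refine Finset.sum_congr rfl fun b _ => ?_
  rw [← Equiv.sum_comp (Equiv.mulRight b)]
  refine Finset.sum_congr rfl fun a _ => ?_
  simp [mul_assoc]

lemma walk_eq {n : ℕ} (hn : 3 ≤ n) (t : ℕ) : walk n 1 t = Aop^[t] (unifOn (cycles n 1)) := by
  induction t with
  | zero =>
    funext σ
    simp only [walk, convPow, conv, Function.iterate_zero, id]
    rw [Finset.sum_eq_single 1]
    · simp
    · intro b _ hb; simp [hb]
    · simp
  | succ t ih =>
    rw [Function.iterate_succ_apply', ← ih, ← conv_tr hn]
    simp only [walk, convPow]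
    rw [conv_assoc']

lemma iter_adj {α : Type*} [Fintype α] [DecidableEq α] (t : ℕ) (f g : Equiv.Perm α → ℝ) :
    ∑ σ, (Aop^[t] f) σ * g σ = ∑ σ, f σ * (Aop^[t] g) σ := by
  induction t generalizing g with
  | zero => rfl
  | succ t ih => rw [Function.iterate_succ_apply', Aop_adj, ih, Function.iterate_succ_apply]

lemma nu_sum {n : ℕ} (g : Equiv.Perm (Fin n) → ℝ) :
    ∑ σ, unifOn (cycles n 1) σ * g σ = (∑ σ ∈ cycles n 1, g σ) / (cycles n 1).card := by
  rw [Finset.sum_div, ← Finset.sum_subset (Finset.subset_univ (cycles n 1))]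
  · refine Finset.sum_congr rfl fun τ hτ => ?_
    rw [unifOn, if_pos hτ]; ring
  · intro τ _ hτ
    rw [unifOn, if_neg hτ, zero_mul]

open Classical in
lemma cyc_eq (n : ℕ) : cycles n 1 = univ.filter (fun σ : Equiv.Perm (Fin n) => NC σ) := by
  ext σ; rw [mem_cyc]; simp

lemma spec' {n : ℕ} (hn : 3 ≤ n) (h : Equiv.Perm (Fin n) → ℝ) (K : ℕ) (c : ℕ → ℝ)
    (H : ∀ x : ℝ, 0 < x → x < 1 → ∑ σ, h σ * W σ x = ∑ k ∈ range K, c k * x ^ k) (t : ℕ) :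
    ((n:ℝ) - 1) * ∑ σ ∈ cycles n 1, (Aop^[t] h) σ = ∑ k ∈ range K, c k * (1 - 2 * k / n) ^ t := by
  have := spec (α := Fin n) (by simpa using hn) h K c H t
  rw [Fintype.card_fin] at this
  rw [← this, cyc_eq]

lemma card_cyc {n : ℕ} (hn : 3 ≤ n) : ((n:ℝ) - 1) * (cycles n 1).card = n.factorial := by
  have := spec' hn (fun σ => ((fx σ).choose 0 : ℝ)) 1 _
    (fun x hx hx1 => sum_choose_W (α := Fin n) 0 (by simp; omega) hx hx1) 0
  simpa [cf] using this

lemma F3 {n : ℕ} (j : ℕ) (hn : 3 ≤ n) (hj : j + 1 < n) (t : ℕ) :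
    ∑ σ, walk n 1 t σ * ((fx σ).choose j : ℝ) =
      1 / j.factorial * ∑ k ∈ range (j + 1), cf j k * (1 - 2 * k / n) ^ t := by
  have := spec' hn (fun σ => ((fx σ).choose j : ℝ)) (j+1) _
    (fun x hx hx1 => sum_choose_W (α := Fin n) j (by simpa using hj) hx hx1) t
  rw [walk_eq hn, iter_adj, nu_sum]
  have hc := card_cyc hn
  have hn' : (3:ℝ) ≤ n := by exact_mod_cast hn
  have h5 : (n:ℝ) - 1 ≠ 0 := by linarith
  have hf : (n.factorial : ℝ) ≠ 0 := by positivity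
  have hc0 : ((cycles n 1).card : ℝ) ≠ 0 := by
    intro h; rw [h, mul_zero] at hc; exact hf hc.symm
  rw [div_eq_iff hc0, ← mul_right_inj' h5, this, mul_left_comm, hc]
  simp only [Fintype.card_fin]
  rw [Finset.mul_sum, Finset.sum_mul]
  refine Finset.sum_congr rfl fun k _ => ?_
  ring

lemma mass {n : ℕ} (hn : 3 ≤ n) (t : ℕ) : ∑ σ, walk n 1 t σ = 1 := by
  have := F3 0 hn (by omega) t
  simpa [cf] using this

/-- coefficients -/
noncomputable def ck (n k : ℕ) : ℝ := 1 - (if k = 1 then 1 else 0) - (if k = n - 1 then 1 else 0)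

lemma ck_sum {n : ℕ} (hn : 3 ≤ n) (g : ℕ → ℝ) :
    ∑ k ∈ range (n + 1), ck n k * g k = ∑ k ∈ range (n + 1), g k - g 1 - g (n - 1) := by
  simp only [ck, sub_mul, Finset.sum_sub_distrib, ite_mul, one_mul, zero_mul, Finset.sum_ite_eq', mem_range]
  rw [if_pos (by omega), if_pos (by omega)]

lemma F2 {n : ℕ} (hn : 3 ≤ n) (t : ℕ) :
    (n.factorial : ℝ) * ∑ σ, (walk n 1 t σ) ^ 2 =
      ∑ k ∈ range (n + 1), ck n k * (1 - 2 * k / n) ^ (2 * t) := by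
  have hc := card_cyc hn
  have hn' : (3:ℝ) ≤ n := by exact_mod_cast hn
  have h5 : (n:ℝ) - 1 ≠ 0 := by linarith
  have hf : (n.factorial : ℝ) ≠ 0 := by positivity
  have hc0 : ((cycles n 1).card : ℝ) ≠ 0 := by
    intro h; rw [h, mul_zero] at hc; exact hf hc.symm
  have := spec' hn (unifOn (cycles n 1)) (n + 1) (ck n) (by
    intro x hx hx1
    rw [nu_sum, Finset.sum_congr rfl (g := fun _ => ∑ k ∈ range (n+1), ck n k * x ^ k), Finset.sum_const,
      nsmul_eq_mul, mul_div_cancel_left₀ _ hc0]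
    intro σ hσ
    rw [NC_W ((mem_cyc σ).1 hσ) (by simpa using hn) hx.le hx1, ck_sum hn]
    simp) (2 * t)
  rw [← this, ← hc]
  have e : ∑ σ, (walk n 1 t σ) ^ 2 = ∑ σ, unifOn (cycles n 1) σ * (Aop^[2 * t] (unifOn (cycles n 1))) σ := by
    simp only [sq]
    rw [two_mul, Function.iterate_add_apply, ← iter_adj, walk_eq hn]
  rw [e, nu_sum]
  field_simp

end wk
end CW

namespace CW
section st

/-- parity sign -/
noncomputable def sr (n t : ℕ) : ℝ := if (t + 1) % 2 = (n - 1) % 2 then 1 else -1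

lemma sr_succ (n t : ℕ) : sr n (t + 1) = - sr n t := by
  unfold sr
  split_ifs with h1 h2 h2
  · omega
  · simp
  · rfl
  · omega

lemma sr_cases (n t : ℕ) : sr n t = 1 ∨ sr n t = -1 := by
  unfold sr; split_ifs <;> simp

lemma sg_one (n : ℕ) (σ : Equiv.Perm (Fin n)) : sg σ = 1 ↔ Equiv.Perm.sign σ = 1 := by
  rcases Int.units_eq_one_or (Equiv.Perm.sign σ) with h | h
  · simp [sg, h]
  · simp [sg, h]; norm_num

lemma sg_neg (n : ℕ) (σ : Equiv.Perm (Fin n)) : sg σ = -1 ↔ ¬ Equiv.Perm.sign σ = 1 := by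
  rw [← sg_one]
  rcases sg_cases σ with h | h <;> rw [h] <;> norm_num

lemma sum_w {n : ℕ} (hn : 2 ≤ n) (s : ℝ) : ∑ σ : Equiv.Perm (Fin n), (1 + s * sg σ) = n.factorial := by
  rw [Finset.sum_add_distrib, ← Finset.mul_sum, sum_sg (by simpa using hn)]
  simp [Finset.card_univ, Fintype.card_perm]

lemma card_even {n : ℕ} (hn : 2 ≤ n) : ((evenPerms n).card : ℝ) = n.factorial / 2 := by
  have h := sum_w hn 1
  have : ∀ σ : Equiv.Perm (Fin n), 1 + 1 * sg σ = if σ ∈ evenPerms n then 2 else 0 := by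
    intro σ
    simp only [evenPerms, mem_filter, mem_univ, true_and, ← sg_one]
    rcases sg_cases σ with h | h <;> rw [h] <;> norm_num
  rw [Finset.sum_congr rfl fun σ _ => this σ] at h
  simp at h
  linarith

lemma card_odd {n : ℕ} (hn : 2 ≤ n) : ((oddPerms n).card : ℝ) = n.factorial / 2 := by
  have h := sum_w hn (-1)
  have : ∀ σ : Equiv.Perm (Fin n), 1 + (-1) * sg σ = if σ ∈ oddPerms n then 2 else 0 := by
    intro σ
    simp only [oddPerms, mem_filter, mem_univ, true_and, ← sg_neg]
    rcases sg_cases σ with h | h <;> rw [h] <;> norm_num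
  rw [Finset.sum_congr rfl fun σ _ => this σ] at h
  simp at h
  linarith

lemma stat_eq {n : ℕ} (hn : 2 ≤ n) (t : ℕ) (σ : Equiv.Perm (Fin n)) :
    stationary n 1 (t + 1) σ = (1 + sr n t * sg σ) / n.factorial := by
  have hf : (n.factorial : ℝ) ≠ 0 := by positivity
  unfold stationary sr
  split_ifs with h
  · rw [unifOn, card_even hn]
    simp only [evenPerms, mem_filter, mem_univ, true_and, ← sg_one]
    rcases sg_cases σ with h | h <;> rw [h]
    · norm_num
    · norm_num
  · rw [unifOn, card_odd hn]
    simp only [oddPerms, mem_filter, mem_univ, true_and, ← sg_neg]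
    rcases sg_cases σ with h | h <;> rw [h]
    · norm_num
    · norm_num

lemma walk_supp {n : ℕ} (hn : 3 ≤ n) (t : ℕ) (σ : Equiv.Perm (Fin n)) (h : sg σ ≠ sr n t) :
    walk n 1 t σ = 0 := by
  rw [walk_eq hn]
  induction t generalizing σ with
  | zero =>
    simp only [Function.iterate_zero, id, unifOn]
    rw [if_neg]
    intro hm
    apply h
    have hc := (mem_cyc σ).1 hm
    have h1 := hc.1.sign
    rw [hc.2, Fintype.card_fin] at h1
    unfold sr sg
    rw [h1]
    rcases Nat.even_or_odd (n - 1) with he | ho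
    · rw [if_neg (by have := Nat.even_iff.1 he; omega)]; simp [he.neg_one_pow]
    · rw [if_pos (by have := Nat.odd_iff.1 ho; omega)]; simp [ho.neg_one_pow]
  | succ t ih =>
    rw [Function.iterate_succ_apply']
    have hs : sg σ = sr n t := by
      rw [sr_succ] at h
      rcases sg_cases σ with h1 | h1 <;> rcases sr_cases n t with h2 | h2 <;> rw [h1, h2] at h <;> rw [h1, h2] <;> exact absurd (by norm_num) h
    have h1 : ∀ i j : Fin n, i ≠ j → (Aop^[t] (unifOn (cycles n 1))) (σ * Equiv.swap i j) = 0 := by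
      intro i j hij
      apply ih
      rw [sg_swap σ hij, hs]
      rcases sr_cases n t with h2 | h2 <;> rw [h2] <;> norm_num
    have h2 : ∀ i : Fin n, ∑ j, (Aop^[t] (unifOn (cycles n 1))) (σ * Equiv.swap i j) = (Aop^[t] (unifOn (cycles n 1))) σ := by
      intro i
      rw [Finset.sum_eq_single i]
      · rw [Equiv.swap_self]; rfl
      · intro j _ hj; exact h1 i j hj.symm
      · simp
    simp only [Aop, h2]
    simp

lemma conv_nonneg {n : ℕ} {f g : Equiv.Perm (Fin n) → ℝ} (hf : ∀ σ, 0 ≤ f σ) (hg : ∀ σ, 0 ≤ g σ) (σ) :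
    0 ≤ conv f g σ := Finset.sum_nonneg fun _ _ => mul_nonneg (hf _) (hg _)

lemma unif_nonneg {n : ℕ} (S : Finset (Equiv.Perm (Fin n))) (σ) : 0 ≤ unifOn S σ := by
  unfold unifOn; split_ifs <;> positivity

lemma convPow_nonneg {n : ℕ} {f : Equiv.Perm (Fin n) → ℝ} (hf : ∀ σ, 0 ≤ f σ) (t : ℕ) : ∀ σ, 0 ≤ convPow f t σ := by
  induction t with
  | zero => intro σ; simp only [convPow]; split_ifs <;> norm_num
  | succ t ih => exact conv_nonneg ih hf

lemma walk_nonneg {n : ℕ} (t : ℕ) (σ) : 0 ≤ walk n 1 t σ :=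
  conv_nonneg (unif_nonneg _) (convPow_nonneg (unif_nonneg _) t) σ

lemma stat_nonneg {n : ℕ} (t : ℕ) (σ) : 0 ≤ stationary n 1 t σ := by
  unfold stationary; split_ifs <;> exact unif_nonneg _ _

lemma stat_choose {n : ℕ} (t j : ℕ) (hj : j + 2 ≤ n) :
    ∑ σ, stationary n 1 (t + 1) σ * ((fx σ).choose j : ℝ) = 1 / j.factorial := by
  have hf : (n.factorial : ℝ) ≠ 0 := by positivity
  simp only [stat_eq (show 2 ≤ n by omega)]
  have e : ∀ σ : Equiv.Perm (Fin n), (1 + sr n t * sg σ) / (n.factorial : ℝ) * ((fx σ).choose j : ℝ) =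
    1 / n.factorial * ((fx σ).choose j : ℝ) + sr n t / n.factorial * (((fx σ).choose j : ℝ) * sg σ) := by
    intro σ; ring
  rw [Finset.sum_congr rfl fun σ _ => e σ, Finset.sum_add_distrib, ← Finset.mul_sum, ← Finset.mul_sum,
    sum_choose_sg j (by simpa using hj), sum_choose_one j (by simp; omega)]
  simp only [Fintype.card_fin]
  field_simp
  ring

lemma stat_mass {n : ℕ} (hn : 2 ≤ n) (t : ℕ) : ∑ σ, stationary n 1 (t + 1) σ = 1 := by
  simpa using stat_choose (n := n) t 0 hn

/-- L2 bound -/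
lemma tv_sq {n : ℕ} (hn : 3 ≤ n) (t : ℕ) :
    4 * (tvDist (walk n 1 t) (stationary n 1 (t + 1))) ^ 2 ≤
      1 / 2 * (∑ k ∈ range (n + 1), ck n k * (1 - 2 * k / n) ^ (2 * t)) - 1 := by
  have hf : (0:ℝ) < (n.factorial : ℝ) := by positivity
  set μ := walk n 1 t with hμ
  set U := stationary n 1 (t + 1) with hU
  set w : Equiv.Perm (Fin n) → ℝ := fun σ => (1 + sr n t * sg σ) / 2 with hw
  have hw2 : ∀ σ, w σ ^ 2 = w σ := by
    intro σ
    rcases sg_cases σ with h1 | h1 <;> rcases sr_cases n t with h2 | h2 <;> simp only [hw, h1, h2] <;> norm_num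
  have hUw : ∀ σ, U σ = 2 / n.factorial * w σ := by
    intro σ; rw [hU, stat_eq (by omega)]; simp only [hw]; ring
  have hμw : ∀ σ, μ σ * w σ = μ σ := by
    intro σ
    by_cases h : sg σ = sr n t
    · have : w σ = 1 := by
        simp only [hw, h]
        rcases sr_cases n t with h2 | h2 <;> rw [h2] <;> norm_num
      rw [this, mul_one]
    · rw [hμ, walk_supp hn t σ h, zero_mul]
  have hsw : ∑ σ, w σ = n.factorial / 2 := by
    simp only [hw]; rw [← Finset.sum_div, sum_w (by omega)]
  have hd : ∀ σ, |μ σ - U σ| = |μ σ - U σ| * w σ := by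
    intro σ
    have h0 : (μ σ - U σ) * w σ = μ σ - U σ := by
      rw [sub_mul, hμw, hUw, mul_assoc, ← sq, hw2]
    have hw0 : 0 ≤ w σ := by rw [← hw2]; positivity
    calc _ = |(μ σ - U σ) * w σ| := by rw [h0]
      _ = _ := by rw [abs_mul, abs_of_nonneg hw0]
  have hcs := Finset.sum_mul_sq_le_sq_mul_sq univ (fun σ => |μ σ - U σ|) w
  simp only [← hd, hw2, hsw, sq_abs] at hcs
  have hsq : ∑ σ, (μ σ - U σ) ^ 2 = ∑ σ, μ σ ^ 2 - 2 / n.factorial := by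
    have : ∀ σ, (μ σ - U σ) ^ 2 = μ σ ^ 2 - 4 / n.factorial * μ σ + 2 / n.factorial * U σ := by
      intro σ
      rw [hUw]
      have := hμw σ
      have h2 := hw2 σ
      linear_combination (-4 / (n.factorial:ℝ)) * this + (2 / (n.factorial:ℝ))^2 * h2
    rw [Finset.sum_congr rfl fun σ _ => this σ, Finset.sum_add_distrib, Finset.sum_sub_distrib,
      ← Finset.mul_sum, ← Finset.mul_sum, mass hn, stat_mass (by omega)]
    ring
  rw [hsq] at hcs
  have h2 := F2 hn t
  rw [← h2]
  unfold tvDist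
  calc _ = (∑ σ, |μ σ - U σ|) ^ 2 := by ring
    _ ≤ _ := hcs
    _ = _ := by rw [hμ]; field_simp

lemma r_bound {n k : ℕ} (t : ℕ) (hn : 0 < n) (hk : k ≤ n) :
    ((1:ℝ) - 2 * k / n) ^ (2 * t) ≤ Real.exp (-4 * t / n) ^ k + Real.exp (-4 * t / n) ^ (n - k) := by
  have key : ∀ k : ℕ, 2 * k ≤ n → ((1:ℝ) - 2 * k / n) ^ (2 * t) ≤ Real.exp (-4 * t / n) ^ k := by
    intro k hk
    have hn' : (0:ℝ) < n := by exact_mod_cast hn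
    have hk' : 2 * (k:ℝ) ≤ n := by exact_mod_cast hk
    have h0 : (0:ℝ) ≤ 1 - 2 * k / n := by
      rw [sub_nonneg, div_le_one hn']; exact hk'
    have h1 : (1:ℝ) - 2 * k / n ≤ Real.exp (-(2 * k / n)) := by
      have := Real.add_one_le_exp (-(2 * k / n : ℝ)); linarith
    calc _ ≤ Real.exp (-(2 * k / n)) ^ (2 * t) := pow_le_pow_left₀ h0 h1 _
      _ = _ := by
        rw [← Real.exp_nat_mul, ← Real.exp_nat_mul]; congr 1; push_cast; ring
  rcases le_total (2 * k) n with h | h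
  · exact (key k h).trans (le_add_of_nonneg_right (by positivity))
  · have := key (n - k) (by omega)
    have hn' : (n:ℝ) ≠ 0 := by positivity
    have e : ((1:ℝ) - 2 * k / n) ^ (2 * t) = ((1:ℝ) - 2 * (n - k : ℕ) / n) ^ (2 * t) := by
      rw [Nat.cast_sub hk, pow_mul, pow_mul]; congr 1; field_simp; ring
    rw [e]
    exact this.trans (le_add_of_nonneg_left (by positivity))

lemma tv_upper {n : ℕ} (hn : 3 ≤ n) {t : ℕ} (ht : 0 < t) :
    tvDist (walk n 1 t) (stationary n 1 (t + 1)) ≤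
      Real.exp (-4 * t / n) / (2 * Real.sqrt (1 - Real.exp (-4 * t / n))) := by
  have h := tv_sq hn t
  set y := Real.exp (-4 * t / n) with hy
  have hy0 : 0 < y := Real.exp_pos _
  have hy1 : y < 1 := by
    rw [hy, Real.exp_lt_one_iff]
    have h1 : (0:ℝ) < t := by exact_mod_cast ht
    have h2 : (0:ℝ) < n := by exact_mod_cast (show 0 < n by omega)
    apply div_neg_of_neg_of_pos _ h2
    linarith
  rw [ck_sum hn (fun k => ((1:ℝ) - 2 * k / n) ^ (2 * t))] at h
  have hb : ∑ k ∈ range (n + 1), ((1:ℝ) - 2 * k / n) ^ (2 * t) - (1 - 2 * (1:ℕ) / n) ^ (2 * t)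
      - (1 - 2 * (n - 1 : ℕ) / n) ^ (2 * t) ≤ 2 + 2 * (y ^ 2 / (1 - y)) := by
    obtain ⟨m, rfl⟩ : ∃ m, n = m + 3 := ⟨n - 3, by omega⟩
    rw [Finset.sum_range_succ, Finset.sum_range_succ, Finset.sum_range_succ', Finset.sum_range_succ']
    have h0 : ∑ k ∈ range m, ((1:ℝ) - 2 * (k + 1 + 1 : ℕ) / (m + 3 : ℕ)) ^ (2 * t) ≤ 2 * (y ^ 2 / (1 - y)) := by
      have hg : ∑ k ∈ range m, y ^ (k + 2) ≤ y ^ 2 / (1 - y) := by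
        have : ∑ k ∈ range m, y ^ (k + 2) = y ^ 2 * ∑ k ∈ range m, y ^ k := by
          rw [Finset.mul_sum]; exact Finset.sum_congr rfl fun k _ => by ring
        rw [this, geom_sum_eq hy1.ne, div_eq_mul_inv (y^2)]
        apply mul_le_mul_of_nonneg_left _ (by positivity)
        have h1 : 0 < 1 - y := by linarith
        rw [← neg_div_neg_eq, neg_sub, neg_sub, ← one_div]
        apply div_le_div_of_nonneg_right _ h1.le
        have : 0 < y ^ m := by positivity
        linarith
      have hr := Finset.sum_range_reflect (fun k => y ^ (k + 2)) m
      calc _ ≤ ∑ k ∈ range m, (y ^ (k + 2) + y ^ (m - 1 - k + 2)) := by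
            refine Finset.sum_le_sum fun k hk => ?_
            have hk := mem_range.1 hk
            have := r_bound (n := m + 3) (k := k + 1 + 1) t (by omega) (by omega)
            rw [← hy, show m + 3 - (k + 1 + 1) = m - 1 - k + 2 by omega] at this
            exact this
        _ ≤ _ := by rw [Finset.sum_add_distrib, hr]; linarith
    have e1 : ((1:ℝ) - 2 * (m + 3 : ℕ) / (m + 3 : ℕ)) ^ (2 * t) = 1 := by
      have : ((m + 3 : ℕ) : ℝ) ≠ 0 := by positivity
      rw [mul_div_assoc, div_self this, pow_mul]; norm_num
    rw [e1]
    simp only [show m + 3 - 1 = m + 2 by omega, Nat.cast_zero, mul_zero, zero_div, sub_zero, one_pow, zero_add]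
    linarith
  have h4 : 4 * (tvDist (walk n 1 t) (stationary n 1 (t + 1))) ^ 2 ≤ y ^ 2 / (1 - y) := by linarith
  have hs : 0 < Real.sqrt (1 - y) := Real.sqrt_pos.2 (by linarith)
  apply le_of_sq_le_sq _ (by positivity)
  rw [div_pow, mul_pow, Real.sq_sqrt (by linarith)]
  have : y ^ 2 / (2 ^ 2 * (1 - y)) = (y ^ 2 / (1 - y)) / 4 := by
    rw [div_div]; congr 1; ring
  rw [this]; linarith

end st
end CW

namespace CW
section lim

lemma alt_sum (f m : ℕ) : ∑ j ∈ range (m + 1), (-1:ℝ) ^ j * (f.choose j : ℝ) =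
    if f = 0 then 1 else (-1) ^ m * ((f - 1).choose m : ℝ) := by
  rcases Nat.eq_zero_or_pos f with rfl | hf
  · rw [Finset.sum_range_succ']
    simp
  · obtain ⟨g, rfl⟩ : ∃ g, f = g + 1 := ⟨f - 1, by omega⟩
    have := Int.alternating_sum_range_choose_eq_choose (n := g) (m := m)
    have h2 : ((∑ i ∈ range (m + 1), ((-1) ^ i * ((g + 1).choose i) : ℤ) : ℤ) : ℝ) = (((-1) ^ m * (g.choose m) : ℤ) : ℝ) := by
      rw [this]
    push_cast at h2
    rw [h2]
    simp

lemma bon_lower (f m : ℕ) : ∑ j ∈ range (2 * m + 2), (-1:ℝ) ^ j * (f.choose j : ℝ) ≤ if f = 0 then 1 else 0 := by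
  rw [alt_sum f (2 * m + 1)]
  split_ifs with h
  · exact le_rfl
  · rw [Odd.neg_one_pow ⟨m, rfl⟩]
    have : (0:ℝ) ≤ ((f - 1).choose (2 * m + 1) : ℝ) := by positivity
    linarith

lemma bon_upper (f m : ℕ) : (if f = 0 then (1:ℝ) else 0) ≤ ∑ j ∈ range (2 * m + 1), (-1:ℝ) ^ j * (f.choose j : ℝ) := by
  rw [alt_sum f (2 * m)]
  split_ifs with h
  · exact le_rfl
  · rw [Even.neg_one_pow ⟨m, by ring⟩]
    positivity

lemma tv_nonneg {n : ℕ} (μ ν : Equiv.Perm (Fin n) → ℝ) : 0 ≤ tvDist μ ν := by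
  unfold tvDist; positivity

lemma tv_le_one {n : ℕ} (hn : 3 ≤ n) (t : ℕ) : tvDist (walk n 1 t) (stationary n 1 (t + 1)) ≤ 1 := by
  unfold tvDist
  have : ∑ σ, |walk n 1 t σ - stationary n 1 (t + 1) σ| ≤ ∑ σ, (walk n 1 t σ + stationary n 1 (t + 1) σ) := by
    refine Finset.sum_le_sum fun σ _ => ?_
    have h1 := walk_nonneg (n := n) t σ
    have h2 := stat_nonneg (n := n) (t + 1) σ
    rw [abs_le]; constructor <;> linarith
  rw [Finset.sum_add_distrib, mass hn, stat_mass (by omega)] at this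
  linarith

lemma tv_lower {n : ℕ} (m : ℕ) (hn : 3 ≤ n) (hm : 2 * m + 3 ≤ n) (t : ℕ) :
    ∑ j ∈ range (2 * m + 2), (-1:ℝ) ^ j * (1 / j.factorial) -
      ∑ j ∈ range (2 * m + 1), (-1:ℝ) ^ j * (1 / j.factorial * ∑ k ∈ range (j + 1), cf j k * (1 - 2 * k / n) ^ t)
    ≤ tvDist (walk n 1 t) (stationary n 1 (t + 1)) := by
  set h : Equiv.Perm (Fin n) → ℝ := fun σ => if fx σ = 0 then 1 else 0 with hh
  have e1 : ∑ j ∈ range (2 * m + 2), (-1:ℝ) ^ j * (1 / j.factorial) ≤ ∑ σ, stationary n 1 (t + 1) σ * h σ := by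
    have : ∑ j ∈ range (2 * m + 2), (-1:ℝ) ^ j * (1 / j.factorial) =
        ∑ σ, stationary n 1 (t + 1) σ * ∑ j ∈ range (2 * m + 2), (-1:ℝ) ^ j * ((fx σ).choose j : ℝ) := by
      simp only [Finset.mul_sum]
      rw [Finset.sum_comm]
      refine Finset.sum_congr rfl fun j hj => ?_
      rw [← stat_choose (n := n) t j (by have := mem_range.1 hj; omega), Finset.mul_sum]
      exact Finset.sum_congr rfl fun σ _ => by ring
    rw [this]
    exact Finset.sum_le_sum fun σ _ => mul_le_mul_of_nonneg_left (bon_lower _ _) (stat_nonneg _ _)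
  have e2 : ∑ σ, walk n 1 t σ * h σ ≤
      ∑ j ∈ range (2 * m + 1), (-1:ℝ) ^ j * (1 / j.factorial * ∑ k ∈ range (j + 1), cf j k * (1 - 2 * k / n) ^ t) := by
    have : ∑ j ∈ range (2 * m + 1), (-1:ℝ) ^ j * (1 / j.factorial * ∑ k ∈ range (j + 1), cf j k * (1 - 2 * k / n) ^ t) =
        ∑ σ, walk n 1 t σ * ∑ j ∈ range (2 * m + 1), (-1:ℝ) ^ j * ((fx σ).choose j : ℝ) := by
      simp only [Finset.mul_sum (s := range (2 * m + 1))]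
      rw [Finset.sum_comm]
      refine Finset.sum_congr rfl fun j hj => ?_
      rw [← F3 (n := n) j hn (by have := mem_range.1 hj; omega), Finset.mul_sum]
      exact Finset.sum_congr rfl fun σ _ => by ring
    rw [this]
    exact Finset.sum_le_sum fun σ _ => mul_le_mul_of_nonneg_left (bon_upper _ _) (walk_nonneg _ _)
  have e3 : ∑ σ, stationary n 1 (t + 1) σ * h σ - ∑ σ, walk n 1 t σ * h σ ≤
      tvDist (walk n 1 t) (stationary n 1 (t + 1)) := by
    have h1 := mass hn t
    have h2 := stat_mass (n := n) (by omega) t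
    have : ∑ σ, stationary n 1 (t + 1) σ * h σ - ∑ σ, walk n 1 t σ * h σ =
        ∑ σ, (h σ - 1 / 2) * (stationary n 1 (t + 1) σ - walk n 1 t σ) := by
      have e : ∀ σ, (h σ - 1 / 2) * (stationary n 1 (t + 1) σ - walk n 1 t σ) =
        stationary n 1 (t + 1) σ * h σ - walk n 1 t σ * h σ - (1 / 2 * stationary n 1 (t + 1) σ - 1 / 2 * walk n 1 t σ) := by
        intro σ; ring
      simp only [e, Finset.sum_sub_distrib, ← Finset.mul_sum, h1, h2]
      ring
    rw [this, tvDist, Finset.mul_sum]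
    refine Finset.sum_le_sum fun σ _ => ?_
    have ha : |h σ - 1 / 2| = 1 / 2 := by
      simp only [hh]; split_ifs <;> norm_num
    calc _ ≤ |(h σ - 1 / 2) * (stationary n 1 (t + 1) σ - walk n 1 t σ)| := le_abs_self _
      _ = _ := by rw [abs_mul, ha, abs_sub_comm]
  linarith

lemma floor_lim {c : ℝ} (hc : 0 < c) : Tendsto (fun n : ℕ => (⌊c * (n:ℝ)⌋₊ : ℝ) / n) atTop (nhds c) :=
  (tendsto_nat_floor_mul_div_atTop hc.le).comp tendsto_natCast_atTop_atTop

lemma r_lim {c : ℝ} (hc : 0 < c) (k : ℕ) :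
    Tendsto (fun n : ℕ => ((1:ℝ) - 2 * k / n) ^ ⌊c * (n:ℝ)⌋₊) atTop (nhds (Real.exp (-2 * c) ^ k)) := by
  have h1 := (Real.tendsto_mul_log_one_add_div_atTop (-2 * k)).comp (tendsto_natCast_atTop_atTop (R := ℝ))
  have h2 := ((floor_lim hc).mul h1)
  have h3 := (Real.continuous_exp.tendsto _).comp h2
  have e : Real.exp (c * (-2 * k)) = Real.exp (-2 * c) ^ k := by
    rw [← Real.exp_nat_mul]; congr 1; ring
  rw [e] at h3
  refine h3.congr' ?_
  filter_upwards [eventually_gt_atTop (2 * k)] with n hn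
  have hn' : 2 * (k:ℝ) < n := by exact_mod_cast hn
  have hk : (0:ℝ) ≤ k := by positivity
  have hn0 : (0:ℝ) < n := by linarith
  have hp : (0:ℝ) < 1 + -2 * k / n := by
    have : 2 * (k:ℝ) / n < 1 := by rw [div_lt_one hn0]; exact hn'
    have e : -2 * (k:ℝ) / n = - (2 * k / n) := by ring
    rw [e]; linarith
  simp only [Function.comp]
  have e2 : (⌊c * (n:ℝ)⌋₊ : ℝ) / n * (n * Real.log (1 + -2 * k / n)) = ⌊c * (n:ℝ)⌋₊ * Real.log (1 + -2 * k / n) := by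
    field_simp
  rw [e2, Real.exp_nat_mul, Real.exp_log hp]
  congr 1; ring

lemma exp_part (b : ℝ) : Tendsto (fun N : ℕ => ∑ j ∈ range N, b ^ j / (j.factorial : ℝ)) atTop (nhds (Real.exp b)) := by
  have := (NormedSpace.expSeries_div_hasSum_exp (𝔸 := ℝ) b).tendsto_sum_nat
  rwa [← congrFun Real.exp_eq_exp_ℝ b] at this

/-- limit lower bounds -/
noncomputable def Bm (a : ℝ) (m : ℕ) : ℝ :=
  ∑ j ∈ range (2 * m + 2), (-1:ℝ) ^ j * (1 / j.factorial) -
    ∑ j ∈ range (2 * m + 1), (-1:ℝ) ^ j * (1 / j.factorial * ∑ k ∈ range (j + 1), cf j k * a ^ k)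

lemma Bm_lim (a : ℝ) : Tendsto (Bm a) atTop (nhds (Real.exp (-1) - (Real.exp (a - 1) - a * Real.exp (a - 1)))) := by
  have g : Tendsto (fun m : ℕ => 2 * m) atTop atTop := tendsto_id.const_mul_atTop' (by norm_num)
  have h1 := (exp_part (-1)).comp ((tendsto_add_atTop_nat 2).comp g)
  have h2 := (exp_part (a - 1)).comp ((tendsto_add_atTop_nat 1).comp g)
  have h3 := (exp_part (a - 1)).comp g
  refine (h1.sub (h2.sub (h3.const_mul a))).congr fun m => ?_
  simp only [Function.comp, Bm, cf_sum]
  congr 1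
  · exact Finset.sum_congr rfl fun j _ => by ring
  · have e : ∀ j ∈ range (2 * m + 1), (-1:ℝ) ^ j * (1 / j.factorial * ((1 - a) ^ j + j * a * (1 - a) ^ (j - 1))) =
        (a - 1) ^ j / j.factorial + (-1:ℝ) ^ j * (1 / j.factorial * (j * a * (1 - a) ^ (j - 1))) := by
      intro j _
      rw [show a - 1 = (-1) * (1 - a) by ring, mul_pow]; ring
    rw [Finset.sum_congr rfl e, Finset.sum_add_distrib, Finset.sum_range_succ' (fun j => (-1:ℝ) ^ j * (1 / j.factorial * (j * a * (1 - a) ^ (j - 1)))),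
      Finset.mul_sum, sub_eq_add_neg, ← Finset.sum_neg_distrib]
    congr 1
    simp only [Nat.cast_zero, zero_mul, mul_zero, add_zero]
    refine Finset.sum_congr rfl fun j _ => ?_
    rw [show a - 1 = (-1) * (1 - a) by ring, mul_pow, Nat.add_sub_cancel, Nat.factorial_succ]
    push_cast
    have : ((j:ℝ) + 1) ≠ 0 := by positivity
    have : (j.factorial : ℝ) ≠ 0 := by positivity
    field_simp
    ring

theorem main (c : ℝ) (hc : 0 < c) :
    (1 - Real.exp (Real.exp (-2 * c)) + Real.exp (Real.exp (-2 * c) - 2 * c)) / Real.exp 1 ≤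
      Filter.liminf (fun n : ℕ =>
        tvDist (walk n 1 ⌊c * (n : ℝ)⌋₊) (stationary n 1 (⌊c * (n : ℝ)⌋₊ + 1)))
        Filter.atTop ∧
    Filter.limsup (fun n : ℕ =>
        tvDist (walk n 1 ⌊c * (n : ℝ)⌋₊) (stationary n 1 (⌊c * (n : ℝ)⌋₊ + 1)))
        Filter.atTop ≤
      Real.exp (-4 * c) / (2 * Real.sqrt (1 - Real.exp (-4 * c))) := by
  set T : ℕ → ℝ := fun n : ℕ => tvDist (walk n 1 ⌊c * (n : ℝ)⌋₊) (stationary n 1 (⌊c * (n : ℝ)⌋₊ + 1)) with hT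
  have T0 : ∀ n, 0 ≤ T n := fun n => tv_nonneg _ _
  have T1 : ∀ᶠ n in atTop, T n ≤ 1 := by
    filter_upwards [eventually_ge_atTop 3] with n hn
    exact tv_le_one hn _
  have bA : IsBoundedUnder (· ≤ ·) atTop T := ⟨1, by simpa using T1⟩
  have bB : IsBoundedUnder (· ≥ ·) atTop T := ⟨0, by rw [eventually_map]; exact Eventually.of_forall T0⟩
  constructor
  · set a := Real.exp (-2 * c) with ha
    have key : ∀ m, Bm a m ≤ liminf T atTop := by
      intro m
      have hl : Tendsto (fun n : ℕ => ∑ j ∈ range (2 * m + 2), (-1:ℝ) ^ j * (1 / j.factorial) -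
          ∑ j ∈ range (2 * m + 1), (-1:ℝ) ^ j * (1 / j.factorial * ∑ k ∈ range (j + 1), cf j k * (1 - 2 * k / n) ^ ⌊c * (n:ℝ)⌋₊))
          atTop (nhds (Bm a m)) := by
        refine Tendsto.sub tendsto_const_nhds ?_
        refine tendsto_finsetSum _ fun j _ => Tendsto.const_mul _ (Tendsto.const_mul _ ?_)
        exact tendsto_finsetSum _ fun k _ => Tendsto.const_mul _ (r_lim hc k)
      rw [← hl.liminf_eq]
      refine liminf_le_liminf ?_ hl.isBoundedUnder_ge bA.isCoboundedUnder_ge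
      filter_upwards [eventually_ge_atTop (2 * m + 3)] with n hn
      exact tv_lower m (by omega) hn _
    have := le_of_tendsto' (Bm_lim a) key
    refine le_trans (le_of_eq ?_) this
    rw [show Real.exp (a - 2 * c) = Real.exp a * a by rw [ha, ← Real.exp_add]; congr 1; ring,
      Real.exp_sub a 1, Real.exp_neg]
    field_simp
    ring
  · have hy : Tendsto (fun n : ℕ => Real.exp (-4 * (⌊c * (n:ℝ)⌋₊ : ℝ) / n)) atTop (nhds (Real.exp (-4 * c))) := by
      have := (Real.continuous_exp.tendsto _).comp ((floor_lim hc).const_mul (-4))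
      refine this.congr fun n => ?_
      simp only [Function.comp]; rw [mul_div_assoc]
    have hlt : Real.exp (-4 * c) < 1 := by rw [Real.exp_lt_one_iff]; linarith
    have hs : 0 < Real.sqrt (1 - Real.exp (-4 * c)) := Real.sqrt_pos.2 (by linarith)
    have hl : Tendsto (fun n : ℕ => Real.exp (-4 * (⌊c * (n:ℝ)⌋₊ : ℝ) / n) / (2 * Real.sqrt (1 - Real.exp (-4 * (⌊c * (n:ℝ)⌋₊ : ℝ) / n))))
        atTop (nhds (Real.exp (-4 * c) / (2 * Real.sqrt (1 - Real.exp (-4 * c))))) := by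
      refine hy.div (Tendsto.const_mul _ ?_) (by positivity)
      exact (Real.continuous_sqrt.tendsto _).comp (hy.const_sub 1)
    rw [← hl.limsup_eq]
    refine limsup_le_limsup ?_ bB.isCoboundedUnder_le hl.isBoundedUnder_le
    have hfl : Tendsto (fun n : ℕ => ⌊c * (n:ℝ)⌋₊) atTop atTop :=
      tendsto_nat_floor_atTop.comp (tendsto_natCast_atTop_atTop.const_mul_atTop hc)
    filter_upwards [eventually_ge_atTop 3, hfl.eventually_gt_atTop 0] with n hn ht
    exact tv_upper hn ht

end lim
end CW

/-- Theorem 1: for the random `(n-1)`-cycle followed by `⌊cn⌋` random transpositions,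
`(1 - e^{e^{-2c}} + e^{e^{-2c}-2c})/e ≤ liminf ‖μ_{t_n+1} - U_{t_n+1}‖_TV` and
`limsup ‖μ_{t_n+1} - U_{t_n+1}‖_TV ≤ e^{-4c}/(2√(1-e^{-4c}))`. -/
theorem cycle_walk_n_sub_one_tv_bounds (c : ℝ) (hc : 0 < c) :
    (1 - Real.exp (Real.exp (-2 * c)) + Real.exp (Real.exp (-2 * c) - 2 * c)) / Real.exp 1 ≤
      Filter.liminf (fun n : ℕ =>
        tvDist (walk n 1 ⌊c * (n : ℝ)⌋₊) (stationary n 1 (⌊c * (n : ℝ)⌋₊ + 1)))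
        Filter.atTop ∧
    Filter.limsup (fun n : ℕ =>
        tvDist (walk n 1 ⌊c * (n : ℝ)⌋₊) (stationary n 1 (⌊c * (n : ℝ)⌋₊ + 1)))
        Filter.atTop ≤
      Real.exp (-4 * c) / (2 * Real.sqrt (1 - Real.exp (-4 * c))) := by
  exact CW.main c hc
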